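/- Let d ≥ 2 be an integer. For a general plane curve C of degree d over ℂ (the zero locus of a general degree-d form), the number of bitangent lines to C (lines having contact order at least 2 with C at each of two distinct points) is exactly d(d−2)(d²−9)/2. -/

import Mathlib

noncomputable section

/-- The restriction of the form `F` to the line through `[v]` and `[w]`,
parametrized by `t ↦ v + t • w`, as a polynomial in `t`. -/
def linePoly (F : MvPolynomial (Fin 3) ℂ) (v w : Fin 3 → ℂ) : Polynomial ℂ :=
  MvPolynomial.aeval (fun i => Polynomial.C (v i) + Polynomial.X * Polynomial.C (w i)) F

/-- The line through the two (projectively distinct) points `[v]`, `[w]` has contact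
order at least `m` with the curve `{F = 0}` at the point `[v]`. -/
def ContactLE (F : MvPolynomial (Fin 3) ℂ) (v w : Fin 3 → ℂ) (m : ℕ) : Prop :=
  (Polynomial.X : Polynomial ℂ) ^ m ∣ linePoly F v w

/-- The member of the pencil spanned by `F` and `G` corresponding to `c ∈ ℙ¹`. -/
def pencilMember (F G : MvPolynomial (Fin 3) ℂ) (c : Projectivization ℂ (Fin 2 → ℂ)) :
    MvPolynomial (Fin 3) ℂ :=
  c.rep 0 • F + c.rep 1 • G

/-- The coefficient vector of a pair of forms. -/
def coeffs2 (F G : MvPolynomial (Fin 3) ℂ) : (Fin 3 →₀ ℕ) ⊕ (Fin 3 →₀ ℕ) → ℂ :=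
  Sum.elim (fun m => MvPolynomial.coeff m F) (fun m => MvPolynomial.coeff m G)

/-- The coefficient vector of a single form. -/
def coeffs1 (F : MvPolynomial (Fin 3) ℂ) : (Fin 3 →₀ ℕ) → ℂ :=
  fun m => MvPolynomial.coeff m F

/-- The set of bitangent lines (as 2-dimensional linear subspaces of `ℂ³`) of the curve
`{F = 0}`: lines having contact order at least 2 with the curve at each of two distinct
points. -/
def bitangentLines (F : MvPolynomial (Fin 3) ℂ) : Set (Submodule ℂ (Fin 3 → ℂ)) :=
  {W | Module.finrank ℂ ↥W = 2 ∧
    ∃ v w : Fin 3 → ℂ, v ∈ W ∧ w ∈ W ∧ LinearIndependent ℂ ![v, w] ∧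
      ContactLE F v w 2 ∧ ContactLE F w v 2}

set_option linter.all false
namespace Bit
open Polynomial

section lp
variable {A : Type*} [CommRing A] [Algebra ℂ A]
abbrev Form := MvPolynomial (Fin 3) ℂ

/-- restriction of `F` to a line, over an arbitrary algebra -/
def lp (F : Form) (v w : Fin 3 → A) : A[X] :=
  MvPolynomial.aeval (fun i => C (v i) + X * C (w i)) F

theorem lp_eq_linePoly (F : Form) (v w : Fin 3 → ℂ) : lp F v w = linePoly F v w := by
  unfold lp linePoly
  congr 1

theorem lp_map {B : Type*} [CommRing B] [Algebra ℂ B] (φ : A →ₐ[ℂ] B) (F : Form) (v w : Fin 3 → A) :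
    (lp F v w).map (φ : A →+* B) = lp F (fun i => φ (v i)) (fun i => φ (w i)) := by
  unfold lp
  have := MvPolynomial.comp_aeval_apply (Polynomial.mapAlgHom φ) (p := F)
    (f := fun i => C (v i) + X * C (w i))
  simp only [map_add, map_mul, Polynomial.coe_mapAlgHom, Polynomial.map_C, Polynomial.map_X] at this
  exact this

theorem lp_eval (F : Form) (v w : Fin 3 → A) (s : A) :
    (lp F v w).eval s = MvPolynomial.aeval (v + s • w) F := by
  unfold lp
  have h := MvPolynomial.comp_aeval_apply (Polynomial.aeval (R := A) s |>.restrictScalars ℂ) (p := F)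
    (f := fun i => C (v i) + X * C (w i))
  simp only [AlgHom.restrictScalars_apply, coe_aeval_eq_eval] at h
  rw [← Polynomial.coe_aeval_eq_eval]
  rw [show (Polynomial.aeval s) ((MvPolynomial.aeval fun i => C (v i) + X * C (w i)) F) = _ from h]
  congr 2
  ext i
  simp
  ring

theorem lp_derivative (F : Form) (v w : Fin 3 → A) :
    derivative (lp F v w) = ∑ i, lp (MvPolynomial.pderiv i F) v w * C (w i) := by
  unfold lp
  induction F using MvPolynomial.induction_on with
  | C a => simp [MvPolynomial.aeval_C, Polynomial.algebraMap_apply]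
  | add p q hp hq => simp only [map_add, hp, hq, add_mul, Finset.sum_add_distrib]
  | mul_X p j hp =>
    have h1 : ∀ i : Fin 3, (MvPolynomial.aeval fun i => C (v i) + X * C (w i))
        (MvPolynomial.pderiv i (p * MvPolynomial.X j)) * C (w i) =
        (MvPolynomial.aeval fun i => C (v i) + X * C (w i)) (MvPolynomial.pderiv i p) * C (w i) *
          (C (v j) + X * C (w j)) + (MvPolynomial.aeval fun i => C (v i) + X * C (w i)) p *
            (if i = j then C (w i) else 0) := by
      intro i
      rw [MvPolynomial.pderiv_mul, MvPolynomial.pderiv_X, map_add, map_mul, map_mul, MvPolynomial.aeval_X]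
      by_cases h : i = j
      · subst h; simp only [Pi.single_eq_same, map_one, if_true]; ring
      · rw [Pi.single_eq_of_ne (Ne.symm h)]; simp only [map_zero, h, if_false]; ring
    rw [Finset.sum_congr rfl (fun i _ => h1 i), Finset.sum_add_distrib, ← Finset.sum_mul,
      ← Finset.mul_sum, ← hp, map_mul, MvPolynomial.aeval_X, derivative_mul]
    simp

theorem pow_deg_reflect (f : A[X]) (hf : f.natDegree ≤ 1) (k : ℕ) :
    (f^k).natDegree ≤ k ∧ reflect k (f^k) = (reflect 1 f)^k := by
  induction k with
  | zero => simp [reflect_C (1:A) 0 |> fun h => by simpa using h]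
  | succ k ih =>
    constructor
    · rw [pow_succ]; exact natDegree_mul_le.trans (add_le_add ih.1 hf)
    · rw [pow_succ, reflect_mul _ _ ih.1 hf, ih.2, pow_succ]

theorem lin_deg (a b : A) : (C a + X * C b).natDegree ≤ 1 := by
  compute_degree

theorem lin_reflect (a b : A) : reflect 1 (C a + X * C b) = C b + X * C a := by
  ext n
  rw [coeff_reflect]
  rcases n with _ | _ | n
  · rw [revAt_le (by omega)]; simp [coeff_C]
  · rw [revAt_le (by omega)]; simp
  · rw [revAt_eq_self_of_lt (by omega)]; simp [coeff_X, coeff_C]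

theorem lp_reflect_aux (d : ℕ) (F : Form) (hF : F.IsHomogeneous d) (v w : Fin 3 → A) :
    (lp F v w).natDegree ≤ d ∧ reflect d (lp F v w) = lp F w v := by
  have key : ∀ m ∈ F.support, ∀ v w : Fin 3 → A,
      (∏ i, (C (v i) + X * C (w i))^(m i)).natDegree ≤ d ∧
      reflect d (∏ i, (C (v i) + X * C (w i))^(m i)) = ∏ i, (C (w i) + X * C (v i))^(m i) := by
    intro m hm v w
    have hdeg : m 0 + m 1 + m 2 = d := by
      have := hF (MvPolynomial.mem_support_iff.mp hm)
      rw [← this, Finsupp.weight_apply, Finsupp.sum_fintype _ _ (by simp)]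
      simp [Fin.sum_univ_three]
    have h := fun i => pow_deg_reflect _ (lin_deg (v i) (w i)) (m i)
    simp only [lin_reflect] at h
    rw [Fin.prod_univ_three, Fin.prod_univ_three, ← hdeg]
    have h01 : ((C (v 0) + X * C (w 0))^(m 0) * (C (v 1) + X * C (w 1))^(m 1)).natDegree ≤ m 0 + m 1 :=
      natDegree_mul_le.trans (add_le_add (h 0).1 (h 1).1)
    refine ⟨natDegree_mul_le.trans (add_le_add h01 (h 2).1), ?_⟩
    rw [reflect_mul _ _ h01 (h 2).1, reflect_mul _ _ (h 0).1 (h 1).1, (h 0).2, (h 1).2, (h 2).2]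
  have e : ∀ v w : Fin 3 → A, lp F v w = ∑ m ∈ F.support, C (algebraMap ℂ A (F.coeff m)) * ∏ i, (C (v i) + X * C (w i))^(m i) := by
    intro v w
    unfold lp
    rw [MvPolynomial.aeval_def, MvPolynomial.eval₂_eq']
    rfl
  constructor
  · rw [e]
    apply natDegree_sum_le_of_forall_le
    intro m hm
    exact (natDegree_C_mul_le _ _).trans (key m hm v w).1
  · rw [e, e w v]
    have hs : ∀ (s : Finset (Fin 3 →₀ ℕ)) (f : (Fin 3 →₀ ℕ) → A[X]), reflect d (∑ m ∈ s, f m) = ∑ m ∈ s, reflect d (f m) := by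
      intro s f
      ext n
      simp [coeff_reflect, finset_sum_coeff]
    rw [hs]
    apply Finset.sum_congr rfl
    intro m hm
    rw [reflect_C_mul, (key m hm v w).2]

theorem lp_natDegree {d : ℕ} {F : Form} (hF : F.IsHomogeneous d) (v w : Fin 3 → A) :
    (lp F v w).natDegree ≤ d := (lp_reflect_aux d F hF v w).1
theorem lp_reflect {d : ℕ} {F : Form} (hF : F.IsHomogeneous d) (v w : Fin 3 → A) :
    reflect d (lp F v w) = lp F w v := (lp_reflect_aux d F hF v w).2
theorem lp_coeff_swap {d : ℕ} {F : Form} (hF : F.IsHomogeneous d) (v w : Fin 3 → A) (i : ℕ) (hi : i ≤ d) :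
    (lp F v w).coeff (d - i) = (lp F w v).coeff i := by
  rw [← lp_reflect hF v w, coeff_reflect, revAt_le hi]

theorem lp_coeff_zero (F : Form) (v w : Fin 3 → A) : (lp F v w).coeff 0 = MvPolynomial.aeval v F := by
  rw [coeff_zero_eq_eval_zero, lp_eval]; simp
theorem lp_coeff_top {d : ℕ} {F : Form} (hF : F.IsHomogeneous d) (v w : Fin 3 → A) :
    (lp F v w).coeff d = MvPolynomial.aeval w F := by
  have := lp_coeff_swap hF v w 0 (by omega)
  simpa [lp_coeff_zero] using this

/-- gradient pairing -/
def gr (F : Form) (v w : Fin 3 → A) : A := ∑ i, MvPolynomial.aeval v (MvPolynomial.pderiv i F) * w i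

theorem lp_coeff_one (F : Form) (v w : Fin 3 → A) : (lp F v w).coeff 1 = gr F v w := by
  have h := congrArg (fun p => p.eval 0) (lp_derivative F v w)
  simp only [← coeff_zero_eq_eval_zero, coeff_derivative] at h
  simp only [Nat.cast_zero, zero_add, mul_one] at h
  rw [h]
  simp [coeff_zero_eq_eval_zero, eval_finset_sum, lp_eval, gr]

theorem lp_coeff_pred {d : ℕ} (hd : 1 ≤ d) {F : Form} (hF : F.IsHomogeneous d) (v w : Fin 3 → A) :
    (lp F v w).coeff (d-1) = gr F w v := by
  rw [lp_coeff_swap hF v w 1 hd, lp_coeff_one]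

theorem lp_eval_derivative (F : Form) (v w : Fin 3 → A) (s : A) :
    (derivative (lp F v w)).eval s = gr F (v + s • w) w := by
  rw [lp_derivative]
  simp [eval_finset_sum, lp_eval, gr]

theorem aeval_add_eps (F : Form) (v w : Fin 3 → A) (s : A) (hs : s * s = 0) :
    MvPolynomial.aeval (v + s • w) F = MvPolynomial.aeval v F + s * gr F v w := by
  rw [← lp_eval, ← lp_coeff_zero F v w, ← lp_coeff_one]
  have := Polynomial.eval_add_of_sq_eq_zero (lp F v w) 0 s (by rw [pow_two, hs])
  rw [zero_add] at this
  rw [this, coeff_zero_eq_eval_zero, mul_comm s, ← coeff_zero_eq_eval_zero (derivative _), coeff_derivative]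
  simp

theorem aeval_smul {d : ℕ} {F : Form} (hF : F.IsHomogeneous d) (c : A) (v : Fin 3 → A) :
    MvPolynomial.aeval (c • v) F = c^d * MvPolynomial.aeval v F := by
  rw [MvPolynomial.aeval_def, MvPolynomial.eval₂_eq', MvPolynomial.aeval_def, MvPolynomial.eval₂_eq', Finset.mul_sum]
  apply Finset.sum_congr rfl
  intro m hm
  have hdeg : ∑ i, m i = d := by
    have := hF (MvPolynomial.mem_support_iff.mp hm)
    rw [← this, Finsupp.weight_apply, Finsupp.sum_fintype _ _ (by simp)]
    simp
  simp only [Pi.smul_apply, smul_eq_mul, mul_pow, Finset.prod_mul_distrib, Finset.prod_pow_eq_pow_sum, hdeg]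
  ring

theorem gr_self {d : ℕ} {F : Form} (hF : F.IsHomogeneous d) (v : Fin 3 → A) :
    gr F v v = d * MvPolynomial.aeval v F := by
  have h := congrArg (MvPolynomial.aeval v) hF.sum_X_mul_pderiv
  simp only [map_sum, map_mul, MvPolynomial.aeval_X, map_nsmul, nsmul_eq_mul, map_natCast] at h
  rw [← h, gr]
  exact Finset.sum_congr rfl (fun i _ => mul_comm _ _)

theorem gr_add (F : Form) (v a b : Fin 3 → A) : gr F v (a + b) = gr F v a + gr F v b := by
  simp [gr, mul_add, Finset.sum_add_distrib]
theorem gr_smul (F : Form) (v : Fin 3 → A) (c : A) (a : Fin 3 → A) : gr F v (c • a) = c * gr F v a := by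
  simp only [gr, Finset.mul_sum, Pi.smul_apply, smul_eq_mul]
  exact Finset.sum_congr rfl (fun i _ => by ring)
theorem aeval_pderiv_smul {d : ℕ} {F : Form} (hF : F.IsHomogeneous d) (c : A) (v : Fin 3 → A) (i : Fin 3) :
    MvPolynomial.aeval (c • v) (MvPolynomial.pderiv i F) = c^(d-1) * MvPolynomial.aeval v (MvPolynomial.pderiv i F) :=
  aeval_smul hF.pderiv c v
theorem gr_smul_left {d : ℕ} {F : Form} (hF : F.IsHomogeneous d) (c : A) (v a : Fin 3 → A) :
    gr F (c • v) a = c^(d-1) * gr F v a := by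
  simp only [gr, Finset.mul_sum, aeval_pderiv_smul hF]
  exact Finset.sum_congr rfl (fun i _ => by ring)

/-- Hessian pairing -/
def hs (F : Form) (v a b : Fin 3 → A) : A := ∑ j, gr (MvPolynomial.pderiv j F) v a * b j

theorem hs_self {d : ℕ} {F : Form} (hF : F.IsHomogeneous d) (v b : Fin 3 → A) :
    hs F v v b = (d - 1 : ℕ) * gr F v b := by
  unfold hs
  simp only [fun j => gr_self (hF.pderiv (i := j)) v]
  rw [gr, Finset.mul_sum]
  exact Finset.sum_congr rfl (fun i _ => by ring)

theorem hs_comm (F : Form) (v a b : Fin 3 → A) : hs F v a b = hs F v b a := by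
  simp only [hs, gr, Finset.sum_mul]
  rw [Finset.sum_comm]
  refine Finset.sum_congr rfl (fun i _ => Finset.sum_congr rfl (fun j _ => ?_))
  have : MvPolynomial.pderiv i (MvPolynomial.pderiv j F) = MvPolynomial.pderiv j (MvPolynomial.pderiv i F) := by
    have h : ⁅(MvPolynomial.pderiv i : Derivation ℂ Form Form), (MvPolynomial.pderiv j : Derivation ℂ Form Form)⁆ = 0 := by
      apply MvPolynomial.derivation_ext
      intro k
      simp [Derivation.commutator_apply, MvPolynomial.pderiv_X, Pi.single_apply, apply_ite]
    have := congrArg (fun D => D F) h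
    simpa [Derivation.commutator_apply, sub_eq_zero] using this
  rw [this]; ring

theorem lp_coeff_two (F : Form) (v w : Fin 3 → A) : 2 * (lp F v w).coeff 2 = hs F v w w := by
  have h := congrArg (fun p => p.coeff 1) (lp_derivative F v w)
  simp only [coeff_derivative, finsetSum_coeff, coeff_mul_C, lp_coeff_one] at h
  rw [hs, ← h]; norm_num; ring

theorem lp_comp (F : Form) (v w : Fin 3 → A) (a b : A) :
    (lp F v w).comp (C b + X * C a) = lp F (v + b • w) (a • w) := by
  unfold lp
  have h := MvPolynomial.comp_aeval_apply (Polynomial.aeval (R := A) (C b + X * C a) |>.restrictScalars ℂ) (p := F)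
    (f := fun i => C (v i) + X * C (w i))
  rw [comp_eq_aeval]
  refine Eq.trans h ?_
  congr 2
  ext1 i
  simp
  ring

theorem lp_smul {d : ℕ} {F : Form} (hF : F.IsHomogeneous d) (v w : Fin 3 → A) (c : A) :
    lp F (c • v) (c • w) = C (c^d) * lp F v w := by
  have := aeval_smul hF (C c) (fun i => C (v i) + X * C (w i))
  rw [C_pow, lp, lp, ← this]
  congr 2
  ext1 i
  simp
  ring

end lp
end Bit

namespace Bit
open Polynomial

section disc
variable {A : Type*} [CommRing A]

def PP (k : ℕ) (g : A[X]) : A[X] := C ((k+1 : ℕ) : A) * g - X * derivative g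

/-- discriminant of a polynomial of formal degree `k+1` -/
def Disc (k : ℕ) (g : A[X]) : A := resultant (PP k g) (derivative g) k k

theorem PP_coeff (k : ℕ) (g : A[X]) (i : ℕ) : (PP k g).coeff i = ((k+1:ℕ) - (i:A)) * g.coeff i := by
  unfold PP
  rw [coeff_sub, coeff_C_mul]
  cases i with
  | zero => simp
  | succ i => rw [coeff_X_mul, coeff_derivative]; push_cast; ring

theorem PP_natDegree (k : ℕ) (g : A[X]) (hg : g.natDegree ≤ k+1) : (PP k g).natDegree ≤ k := by
  rw [natDegree_le_iff_coeff_eq_zero]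
  intro N hN
  rw [PP_coeff]
  rcases (Nat.succ_le_of_lt hN).eq_or_lt with h | h
  · subst h; push_cast; ring
  · rw [coeff_eq_zero_of_natDegree_lt (lt_of_le_of_lt hg h), mul_zero]

theorem der_natDegree (k : ℕ) (g : A[X]) (hg : g.natDegree ≤ k+1) : (derivative g).natDegree ≤ k := by
  have := natDegree_derivative_le g
  omega

theorem PP_map {B : Type*} [CommRing B] (φ : A →+* B) (k : ℕ) (g : A[X]) :
    PP k (g.map φ) = (PP k g).map φ := by
  simp [PP, derivative_map]

theorem Disc_map {B : Type*} [CommRing B] (φ : A →+* B) (k : ℕ) (g : A[X]) :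
    Disc k (g.map φ) = φ (Disc k g) := by
  rw [Disc, Disc, PP_map, derivative_map, resultant_map_map]

theorem PP_eval_of_root (k : ℕ) (g : A[X]) (r : A) (h : (derivative g).eval r = 0) :
    (PP k g).eval r = (k+1:ℕ) * g.eval r := by
  simp [PP, h]

theorem Disc_of_double (k : ℕ) (hk : k ≠ 0) (g : A[X]) (hg : g.natDegree ≤ k+1) (r : A)
    (h0 : g.eval r = 0) (h1 : (derivative g).eval r = 0) : Disc k g = 0 := by
  obtain ⟨p, q, -, -, h⟩ := exists_mul_add_mul_eq_C_resultant (PP k g) (derivative g)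
    (PP_natDegree k g hg) (der_natDegree k g hg) (Or.inl hk)
  have := congrArg (eval r) h
  simp [PP_eval_of_root, h0, h1] at this
  exact this.symm

theorem Disc_of_low (k : ℕ) (hk : k ≠ 0) (g : A[X]) (hg : g.natDegree + 1 ≤ k) : Disc k g = 0 := by
  apply resultant_eq_zero_of_lt_lt
  · have := natDegree_sub_le (C ((k+1 : ℕ) : A) * g) (X * derivative g)
    have h1 := natDegree_C_mul_le ((k+1 : ℕ) : A) g
    have h2 := natDegree_mul_le (p := (X : A[X])) (q := derivative g)
    have h3 := natDegree_derivative_le g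
    have h4 := natDegree_X_le (R := A)
    by_cases h0 : g.natDegree = 0
    · obtain ⟨c, hc⟩ := natDegree_eq_zero.mp h0
      rw [PP, ← hc]
      simp only [derivative_C, mul_zero, sub_zero, ← C_mul, natDegree_C]; omega
    · unfold PP; omega
  · have h3 := natDegree_derivative_le g
    omega

theorem Disc_factor [Nontrivial A] (k : ℕ) (hk : k ≠ 0) (g : A[X]) (hg : g.natDegree ≤ k + 1)
    (hc : (derivative g).coeff k ≠ 0) (r : A) (hr : (derivative g).eval r = 0) :
    ∃ m : A[X], derivative g = (X - C r) * m ∧ m.natDegree = k - 1 ∧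
      Disc k g = (-1)^k * ((k+1:ℕ) * g.eval r) * resultant (PP k g) m k (k-1) := by
  obtain ⟨m, hm⟩ := dvd_iff_isRoot.mpr hr
  have hd : (derivative g).natDegree = k := natDegree_eq_of_le_of_coeff_ne_zero (der_natDegree k g hg) hc
  have hm0 : m ≠ 0 := by
    rintro rfl
    rw [hm] at hc; simp at hc
  have hmd : m.natDegree = k - 1 := by
    rw [hm, (monic_X_sub_C r).natDegree_mul' hm0, natDegree_X_sub_C] at hd
    omega
  refine ⟨m, hm, hmd, ?_⟩
  unfold Disc
  have := resultant_mul_right (PP k g) (X - C r) m k (PP_natDegree k g hg)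
  rw [← hm, hmd, natDegree_X_sub_C, show 1 + (k-1) = k by omega] at this
  rw [this, resultant_comm _ (X - C r), resultant_X_sub_C_left _ _ _ (PP_natDegree k g hg), PP_eval_of_root k g r hr]
  simp
end disc

theorem res_comp (k : ℕ) (P Q : ℂ[X]) (hP : P.natDegree ≤ k) (hQ : Q.natDegree ≤ k) (a b : ℂ) (ha : a ≠ 0) :
    resultant (P.comp (C a * X + C b)) (Q.comp (C a * X + C b)) k k = a^(k*k) * resultant P Q k k := by
  have hl : (C a * X + C b).natDegree = 1 := natDegree_linear ha
  have key : ∀ P Q : ℂ[X], P.natDegree = k → Q.natDegree ≤ k →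
    resultant (P.comp (C a * X + C b)) (Q.comp (C a * X + C b)) k k = a^(k*k) * resultant P Q k k := by
    intro P Q hP hQ
    have hP' : (P.comp (C a * X + C b)).natDegree = k := by rw [natDegree_comp, hl, hP, mul_one]
    have hQ' : (Q.comp (C a * X + C b)).natDegree ≤ k := by rw [natDegree_comp, hl, mul_one]; exact hQ
    have e1 := resultant_eq_prod_eval P Q k hQ (IsAlgClosed.splits P)
    have e2 := resultant_eq_prod_eval (P.comp (C a * X + C b)) (Q.comp (C a * X + C b)) k hQ' (IsAlgClosed.splits _)
    rw [hP] at e1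
    rw [hP'] at e2
    rw [e1, e2, leadingCoeff_comp (by rw [hl]; simp), leadingCoeff_linear ha, hP, mul_pow, ← pow_mul,
      ← map_roots_comp_C_mul_X_add_C P a b ha.isUnit, Multiset.map_map]
    simp only [eval_comp, Function.comp_def, eval_add, eval_mul, eval_C, eval_X]
    ring
  rcases hP.eq_or_lt with h | h
  · exact key P Q h hQ
  · rcases hQ.eq_or_lt with h' | h'
    · rw [resultant_comm, key Q P h' hP, resultant_comm Q P, mul_left_comm, ← mul_assoc ((-1)^_) ((-1)^_), ← mul_pow]
      simp
    · rw [resultant_eq_zero_of_lt_lt _ _ _ _ h h', resultant_eq_zero_of_lt_lt, mul_zero]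
      · rwa [natDegree_comp, hl, mul_one]
      · rwa [natDegree_comp, hl, mul_one]

theorem Disc_comp (k : ℕ) (g : ℂ[X]) (hg : g.natDegree ≤ k+1) (a b c : ℂ) (ha : a ≠ 0) :
    Disc k (C c * g.comp (C a * X + C b)) = c^(2*k) * a^(k*(k+1)) * Disc k g := by
  unfold Disc
  have e1 : derivative (C c * g.comp (C a * X + C b)) = C (c * a) * (derivative g).comp (C a * X + C b) := by
    simp [derivative_comp]; ring
  have e2 : PP k (C c * g.comp (C a * X + C b)) = C c * ((PP k g).comp (C a * X + C b) +
      (derivative g).comp (C a * X + C b) * C b) := by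
    rw [PP, e1, PP]; simp; ring
  have hl : (C a * X + C b).natDegree = 1 := natDegree_linear ha
  rw [e1, e2, resultant_C_mul_right, resultant_C_mul_left, resultant_add_mul_left, res_comp k _ _ (PP_natDegree k g hg) (der_natDegree k g hg) a b ha]
  · ring
  · simp
  · rw [natDegree_comp, hl, mul_one]; exact der_natDegree k g hg

theorem Disc_eq_zero (k : ℕ) (g : ℂ[X]) (hg : g.natDegree ≤ k+1) (h : Disc k g = 0) :
    (∃ r, g.eval r = 0 ∧ (derivative g).eval r = 0) ∨ (g.coeff k = 0 ∧ g.coeff (k+1) = 0) := by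
  have key : ∀ P Q : ℂ[X], P.coeff k ≠ 0 → P.natDegree ≤ k → Q.natDegree ≤ k → resultant P Q k k = 0 → ∃ r, P.eval r = 0 ∧ Q.eval r = 0 := by
    intro P Q hc hP hQ hr
    have hP' : P.natDegree = k := natDegree_eq_of_le_of_coeff_ne_zero hP hc
    have e1 := resultant_eq_prod_eval P Q k hQ (IsAlgClosed.splits P)
    rw [hP', hr] at e1
    have hl : P.leadingCoeff ≠ 0 := by rwa [leadingCoeff, hP']
    have := (mul_eq_zero.mp e1.symm).resolve_left (pow_ne_zero _ hl)
    rw [Multiset.prod_eq_zero_iff, Multiset.mem_map] at this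
    obtain ⟨r, hr, h0⟩ := this
    exact ⟨r, (mem_roots'.mp hr).2, h0⟩
  have hk : ((k+1:ℕ):ℂ) ≠ 0 := Nat.cast_ne_zero.mpr (by omega)
  have fin : (∃ r, (PP k g).eval r = 0 ∧ (derivative g).eval r = 0) → (∃ r, g.eval r = 0 ∧ (derivative g).eval r = 0) := by
    rintro ⟨r, h1, h2⟩
    rw [PP_eval_of_root k g r h2] at h1
    exact ⟨r, (mul_eq_zero.mp h1).resolve_left hk, h2⟩
  by_cases h1 : g.coeff k = 0
  · by_cases h2 : g.coeff (k+1) = 0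
    · exact Or.inr ⟨h1, h2⟩
    · left
      apply fin
      unfold Disc at h
      rw [resultant_comm] at h
      have h := (mul_eq_zero.mp h).resolve_left (by simp)
      obtain ⟨r, a, b⟩ := key _ _ (by rw [coeff_derivative]; exact mul_ne_zero h2 (by exact_mod_cast hk)) (der_natDegree k g hg) (PP_natDegree k g hg) h
      exact ⟨r, b, a⟩
  · left
    apply fin
    exact key _ _ (by rw [PP_coeff]; simpa using h1) (PP_natDegree k g hg) (der_natDegree k g hg) h

/-- lifting a simple root to dual numbers -/
theorem lift_root (f : (DualNumber ℂ)[X]) (r : ℂ)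
    (h0 : (f.map (TrivSqZeroExt.fstHom ℂ ℂ ℂ : DualNumber ℂ →+* ℂ)).eval r = 0)
    (h1 : (derivative (f.map (TrivSqZeroExt.fstHom ℂ ℂ ℂ : DualNumber ℂ →+* ℂ))).eval r ≠ 0) :
    ∃ s : DualNumber ℂ, s.fst = r ∧ f.eval s = 0 := by
  set φ := (TrivSqZeroExt.fstHom ℂ ℂ ℂ : DualNumber ℂ →+* ℂ) with hφ
  have hfst : ∀ x, φ x = x.fst := fun x => rfl
  set r0 : DualNumber ℂ := TrivSqZeroExt.inl r with hr0
  have hr : φ r0 = r := by simp [hfst, hr0]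
  have a0 : (f.eval r0).fst = 0 := by rw [← hfst, ← hr] at *; rw [← Polynomial.eval_map_apply]; exact h0
  have a1 : ((derivative f).eval r0).fst ≠ 0 := by
    rw [← hfst]; rw [derivative_map, ← hr, Polynomial.eval_map_apply] at h1; exact h1
  let ρ := - (f.eval r0).snd / ((derivative f).eval r0).fst
  refine ⟨r0 + TrivSqZeroExt.inr ρ, by simp [hr0], ?_⟩
  rw [eval_add_of_sq_eq_zero _ _ _ (by rw [pow_two]; simp)]
  ext
  · simp [a0]
  · simp [ρ]; field_simp; ring

abbrev fstR : DualNumber ℂ →+* ℂ := (TrivSqZeroExt.fstHom ℂ ℂ ℂ : DualNumber ℂ →+* ℂ)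

theorem Disc_dual (k : ℕ) (hk : k ≠ 0) (g : (DualNumber ℂ)[X]) (hg : g.natDegree ≤ k + 1)
    (hc : (g.map fstR).coeff (k+1) ≠ 0) (r : ℂ) (h0 : (g.map fstR).eval r = 0)
    (h1 : (derivative (g.map fstR)).eval r = 0)
    (h2 : (derivative (derivative (g.map fstR))).eval r ≠ 0)
    (hu : ∀ s, (g.map fstR).eval s = 0 → (derivative (g.map fstR)).eval s = 0 → s = r) :
    ∃ s : DualNumber ℂ, s.fst = r ∧ (Disc k g = 0 → g.eval s = 0) := by
  rw [derivative_map] at h1 h2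
  obtain ⟨s, hs, hs0⟩ := lift_root (derivative g) r h1 h2
  refine ⟨s, hs, fun hD => ?_⟩
  have hk1 : ((k+1:ℕ):ℂ) ≠ 0 := Nat.cast_ne_zero.mpr (by omega)
  have hc' : ((derivative g).map fstR).coeff k ≠ 0 := by
    rw [← derivative_map, coeff_derivative]
    exact mul_ne_zero hc (by exact_mod_cast hk1)
  obtain ⟨m, hm, hmd, hD'⟩ := Disc_factor k hk g hg (by
    intro h; apply hc'; rw [coeff_map, h, map_zero]) s hs0
  have hm' : (derivative g).map fstR = (X - C r) * m.map fstR := by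
    rw [hm, Polynomial.map_mul]
    congr 1
    rw [Polynomial.map_sub, map_X, map_C]
    congr 2
  have hmd' : (m.map fstR).natDegree = k - 1 := by
    apply le_antisymm
    · exact natDegree_map_le.trans hmd.le
    · by_contra hlt
      push Not at hlt
      apply hc'
      apply coeff_eq_zero_of_natDegree_lt
      rw [hm']
      refine lt_of_le_of_lt natDegree_mul_le ?_
      rw [natDegree_X_sub_C]; omega
  have hR : fstR (resultant (PP k g) m k (k-1)) ≠ 0 := by
    rw [← resultant_map_map, ← PP_map, resultant_comm]
    have hgd : (g.map fstR).natDegree ≤ k+1 := natDegree_map_le.trans hg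
    have e1 := resultant_eq_prod_eval (m.map fstR) (PP k (g.map fstR)) k (PP_natDegree k _ hgd) (IsAlgClosed.splits _)
    rw [hmd'] at e1
    rw [e1]
    have hm0 : m.map fstR ≠ 0 := by
      intro h; rw [hm', h] at hc'; simp at hc'
    refine mul_ne_zero (by simp) (mul_ne_zero (pow_ne_zero _ (leadingCoeff_ne_zero.mpr hm0)) ?_)
    rw [Ne, Multiset.prod_eq_zero_iff, Multiset.mem_map]
    rintro ⟨x, hx, hx0⟩
    have hx1 := (mem_roots'.mp hx).2
    rw [IsRoot.def] at hx1
    have hx2 : (derivative (g.map fstR)).eval x = 0 := by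
      rw [derivative_map, hm', eval_mul, hx1, mul_zero]
    rw [PP_eval_of_root _ _ _ hx2] at hx0
    have hxr := hu x ((mul_eq_zero.mp hx0).resolve_left hk1) hx2
    subst hxr
    rw [hm'] at h2
    apply h2
    simp [derivative_mul, hx1]
  rw [hD'] at hD
  have hu1 : IsUnit (resultant (PP k g) m k (k-1)) := by
    rw [TrivSqZeroExt.isUnit_iff_isUnit_fst]; exact isUnit_iff_ne_zero.mpr hR
  have hu2 : IsUnit ((k+1:ℕ) : DualNumber ℂ) := by
    rw [TrivSqZeroExt.isUnit_iff_isUnit_fst]; exact isUnit_iff_ne_zero.mpr (by simpa using hk1)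
  have hu3 : IsUnit ((-1:DualNumber ℂ)^k) := (isUnit_one.neg).pow k
  have e := (hu1.mul_left_eq_zero).mp hD
  have e := (hu3.mul_right_eq_zero).mp e
  exact (hu2.mul_right_eq_zero).mp e

end Bit

namespace Bit
open Polynomial

section
variable {A : Type*} [CommRing A] [Algebra ℂ A]

def nb (F : Form) (p : Fin 3 → A) : Fin 3 → A := fun i => MvPolynomial.aeval p (MvPolynomial.pderiv i F)
def cr (a b : Fin 3 → A) : Fin 3 → A := ![a 1 * b 2 - a 2 * b 1, a 2 * b 0 - a 0 * b 2, a 0 * b 1 - a 1 * b 0]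
def dt (a b : Fin 3 → A) : A := a 0 * b 0 + a 1 * b 1 + a 2 * b 2

theorem gr_eq_dt (F : Form) (p w : Fin 3 → A) : gr F p w = dt (nb F p) w := by
  simp [gr, dt, nb, Fin.sum_univ_three]
theorem dt_cr_left (a b : Fin 3 → A) : dt a (cr a b) = 0 := by simp [dt, cr]; ring
theorem dt_cr_right (a b : Fin 3 → A) : dt b (cr a b) = 0 := by simp [dt, cr]; ring

/-- the auxiliary tangent point -/
def qu (F : Form) (u : Fin 3 → ℂ) (p : Fin 3 → A) : Fin 3 → A := cr (nb F p) (fun i => algebraMap ℂ A (u i))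
/-- the polynomial whose discriminant detects bitangency -/
def DD (k : ℕ) (F : Form) (u : Fin 3 → ℂ) (p : Fin 3 → A) : A := Disc k (lp F (qu F u p) p)

theorem map_qu {B : Type*} [CommRing B] [Algebra ℂ B] (φ : A →ₐ[ℂ] B) (F : Form) (u : Fin 3 → ℂ) (p : Fin 3 → A) :
    (fun i => φ (qu F u p i)) = qu F u (fun i => φ (p i)) := by
  have h : ∀ i, φ (nb F p i) = nb F (fun i => φ (p i)) i := by
    intro i
    simp only [nb]
    exact MvPolynomial.comp_aeval_apply (f := p) φ _
  funext i
  fin_cases i <;> simp [qu, cr, h]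

theorem map_DD {B : Type*} [CommRing B] [Algebra ℂ B] (φ : A →ₐ[ℂ] B) (k : ℕ) (F : Form) (u : Fin 3 → ℂ) (p : Fin 3 → A) :
    φ (DD k F u p) = DD k F u (fun i => φ (p i)) := by
  unfold DD
  rw [← map_qu, ← lp_map, Disc_map]; rfl

theorem natDegree_two {d : ℕ} {F : Form} (hd : 2 ≤ d) (hF : F.IsHomogeneous d) (p q : Fin 3 → A)
    (h0 : MvPolynomial.aeval p F = 0) (h1 : gr F p q = 0) : (lp F q p).natDegree ≤ d - 2 := by
  rw [natDegree_le_iff_coeff_eq_zero]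
  intro N hN
  rcases Nat.lt_or_ge d N with h | h
  · exact coeff_eq_zero_of_natDegree_lt ((lp_natDegree hF q p).trans_lt h)
  · obtain rfl | rfl : N = d ∨ N = d - 1 := by omega
    · rw [lp_coeff_top hF, h0]
    · rw [lp_coeff_pred (by omega) hF, h1]

theorem gr_qu (F : Form) (u : Fin 3 → ℂ) (p : Fin 3 → A) : gr F p (qu F u p) = 0 := by
  rw [gr_eq_dt, qu, dt_cr_left]
theorem dt_qu (F : Form) (u : Fin 3 → ℂ) (p : Fin 3 → A) : dt (fun i => algebraMap ℂ A (u i)) (qu F u p) = 0 := by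
  rw [qu, dt_cr_right]
end

def grL (F : Form) (v : Fin 3 → ℂ) : (Fin 3 → ℂ) →ₗ[ℂ] ℂ where
  toFun := gr F v
  map_add' := gr_add F v
  map_smul' := gr_smul F v

theorem span3 (n : (Fin 3 → ℂ) →ₗ[ℂ] ℂ) (p q c : Fin 3 → ℂ) (hp : n p = 0) (hq : n q = 0)
    (hli : LinearIndependent ℂ ![p, q]) (hc : n c ≠ 0) (w : Fin 3 → ℂ) :
    ∃ α β : ℂ, w = α • p + β • q + (n w / n c) • c := by
  have hs : Submodule.span ℂ {p, q} = LinearMap.ker n := by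
    apply Submodule.eq_of_le_of_finrank_eq
    · rw [Submodule.span_le]
      rintro x (rfl | rfl)
      · exact hp
      · exact hq
    · have h1 := LinearMap.finrank_range_add_finrank_ker n
      have h2 : LinearMap.range n = ⊤ := by
        rw [LinearMap.range_eq_top]
        intro y
        exact ⟨(y / n c) • c, by simp [hc]⟩
      rw [h2] at h1
      have h3 := finrank_span_eq_card hli
      rw [Matrix.range_cons, Matrix.range_cons, Matrix.range_empty, Set.union_empty] at h3
      simp at h1 h3
      rw [show ({p, q} : Set (Fin 3 → ℂ)) = {p} ∪ {q} from rfl] at *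
      simp
      omega
  have hw : w - (n w / n c) • c ∈ Submodule.span ℂ {p, q} := by
    rw [hs, LinearMap.mem_ker]; simp [hc]
  obtain ⟨α, β, h⟩ := Submodule.mem_span_pair.mp hw
  exact ⟨α, β, by rw [h]; simp⟩

theorem contact_iff (F : Form) (v w : Fin 3 → ℂ) : ContactLE F v w 2 ↔ MvPolynomial.aeval v F = 0 ∧ gr F v w = 0 := by
  rw [ContactLE, ← lp_eq_linePoly, X_pow_dvd_iff, ← lp_coeff_zero F v w, ← lp_coeff_one]
  constructor
  · intro h; exact ⟨h 0 (by omega), h 1 (by omega)⟩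
  · rintro ⟨h0, h1⟩ i hi
    interval_cases i <;> assumption

def IsT (F : Form) (p : Fin 3 → ℂ) : Prop :=
  ∃ w, LinearIndependent ℂ ![p, w] ∧ ContactLE F p w 2 ∧ ContactLE F w p 2

structure Smooth (F : Form) : Prop where
  sm : ∀ v : Fin 3 → ℂ, v ≠ 0 → ∃ w, ¬ ContactLE F v w 2

structure Good (d : ℕ) (F : Form) : Prop extends Smooth F where
  ga : ∀ v w, LinearIndependent ℂ ![v, w] → (linePoly F w v).natDegree + 4 ≤ d → False
  gb : ∀ v w, LinearIndependent ℂ ![v, w] → ∀ a : ℂ, (linePoly F w v).natDegree + 3 ≤ d →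
    (X - C a)^2 ∣ linePoly F w v → False
  gc : ∀ v w, LinearIndependent ℂ ![v, w] → ∀ a b : ℂ, (linePoly F w v).natDegree + 2 ≤ d →
    (X - C a)^2 * (X - C b)^2 ∣ linePoly F w v → False

theorem Smooth.exists {F : Form} (h : Smooth F) (v : Fin 3 → ℂ) (hv : v ≠ 0) (h0 : MvPolynomial.aeval v F = 0) :
    ∃ c, gr F v c ≠ 0 := by
  obtain ⟨w, hw⟩ := h.sm v hv
  exact ⟨w, fun h => hw ((contact_iff F v w).mpr ⟨h0, h⟩)⟩

theorem li_smul_eq {p q : Fin 3 → ℂ} (h : LinearIndependent ℂ ![p, q]) (a b : ℂ) (e : a • p + b • q = 0) : a = 0 ∧ b = 0 :=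
  LinearIndependent.pair_iff.mp h a b e

theorem dt_add (a b c : Fin 3 → ℂ) : dt a (b + c) = dt a b + dt a c := by simp [dt]; ring
theorem dt_smul (a b : Fin 3 → ℂ) (c : ℂ) : dt a (c • b) = c * dt a b := by simp [dt]; ring

theorem nb_ne {F : Form} (h : Smooth F) (v : Fin 3 → ℂ) (hv : v ≠ 0) (h0 : MvPolynomial.aeval v F = 0) : nb F v ≠ 0 := by
  obtain ⟨c, hc⟩ := h.exists v hv h0
  intro hn
  rw [gr_eq_dt, hn] at hc
  simp [dt] at hc

theorem cr_eq_zero {a b : Fin 3 → ℂ} (ha : a ≠ 0) (h : cr a b = 0) : ∃ c : ℂ, b = c • a := by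
  have h0 := congrFun h 0
  have h1 := congrFun h 1
  have h2 := congrFun h 2
  simp [cr] at h0 h1 h2
  obtain ⟨i, hi⟩ : ∃ i, a i ≠ 0 := by
    by_contra hh; push Not at hh; exact ha (funext hh)
  refine ⟨b i / a i, ?_⟩
  funext j
  rw [Pi.smul_apply, smul_eq_mul]
  field_simp
  fin_cases i <;> fin_cases j <;> simp at * <;>
    first | ring1 | linear_combination h0 | linear_combination -h0 | linear_combination h1 | linear_combination -h1 |
      linear_combination h2 | linear_combination -h2

theorem li_qu {d : ℕ} {F : Form} (hF : F.IsHomogeneous d) (hs : Smooth F) (u p : Fin 3 → ℂ) (hu : dt u p ≠ 0)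
    (h0 : MvPolynomial.aeval p F = 0) : LinearIndependent ℂ ![p, qu F u p] := by
  have hp : p ≠ 0 := by rintro rfl; simp [dt] at hu
  have hn := nb_ne hs p hp h0
  have hnp : dt (nb F p) p = 0 := by rw [← gr_eq_dt, gr_self hF, h0, mul_zero]
  have hq : qu F u p ≠ 0 := by
    intro h
    obtain ⟨c, hc⟩ := cr_eq_zero hn h
    apply hu
    have : u = c • nb F p := hc
    rw [this]
    have : dt (c • nb F p) p = c * dt (nb F p) p := by simp [dt]; ring
    rw [this, hnp, mul_zero]
  rw [LinearIndependent.pair_iff]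
  intro s t h
  have h1 : dt u (s • p + t • qu F u p) = 0 := by rw [h]; simp [dt]
  rw [dt_add, dt_smul, dt_smul, show dt u (qu F u p) = 0 from dt_qu F u p, mul_zero, add_zero] at h1
  have hs0 := (mul_eq_zero.mp h1).resolve_right hu
  subst hs0
  simp at h
  exact ⟨rfl, h.resolve_right hq⟩

theorem natDegree_qu {d : ℕ} {F : Form} (hd : 2 ≤ d) (hF : F.IsHomogeneous d) {A : Type*} [CommRing A] [Algebra ℂ A]
    (u : Fin 3 → ℂ) (p : Fin 3 → A) (h0 : MvPolynomial.aeval p F = 0) : (lp F (qu F u p) p).natDegree ≤ d - 2 :=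
  natDegree_two hd hF p _ h0 (gr_qu F u p)

theorem li_add {p q : Fin 3 → ℂ} (h : LinearIndependent ℂ ![p, q]) (r : ℂ) : LinearIndependent ℂ ![p, q + r • p] := by
  rw [LinearIndependent.pair_iff] at *
  intro s t e
  have := h (s + t * r) t (by rw [← e]; module)
  obtain ⟨h1, rfl⟩ := this
  simpa using h1

theorem li_swap {p q : Fin 3 → ℂ} (h : LinearIndependent ℂ ![p, q]) : LinearIndependent ℂ ![q, p] :=
  LinearIndependent.pair_symm_iff.mp h

/-- a bitangency point produces a double root -/
theorem T_root {d : ℕ} {F : Form} (hF : F.IsHomogeneous d) (hs : Smooth F) (p q : Fin 3 → ℂ)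
    (hli : LinearIndependent ℂ ![p, q]) (hq : gr F p q = 0) (w : Fin 3 → ℂ) (hw : LinearIndependent ℂ ![p, w])
    (h1 : ContactLE F p w 2) (h2 : ContactLE F w p 2) :
    ∃ α r : ℂ, α ≠ 0 ∧ w = α • (q + r • p) ∧ (lp F q p).eval r = 0 ∧ (derivative (lp F q p)).eval r = 0 := by
  rw [contact_iff] at h1 h2
  have hp : p ≠ 0 := hli.ne_zero 0
  obtain ⟨c, hc⟩ := hs.exists p hp h1.1
  have hpp : grL F p p = 0 := (gr_self hF p).trans (by rw [h1.1, mul_zero])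
  obtain ⟨β, α, e⟩ := span3 (grL F p) p q c hpp hq hli hc w
  rw [show grL F p w = 0 from h1.2, zero_div, zero_smul, add_zero] at e
  have hα : α ≠ 0 := by
    rintro rfl
    have := li_swap hw
    rw [LinearIndependent.pair_iff] at this
    have := this 1 (-β) (by rw [e]; module)
    simp at this
  have e' : w = α • (q + (β/α) • p) := by
    rw [e, smul_add, smul_smul, mul_div_cancel₀ _ hα, add_comm]
  refine ⟨α, β / α, hα, e', ?_, ?_⟩
  · rw [lp_eval]
    have := h2.1
    rw [e', aeval_smul hF] at this
    exact (mul_eq_zero.mp this).resolve_left (pow_ne_zero _ hα)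
  · rw [lp_eval_derivative]
    have := h2.2
    rw [e', gr_smul_left hF] at this
    exact (mul_eq_zero.mp this).resolve_left (pow_ne_zero _ hα)

theorem root_T {d : ℕ} {F : Form} (hF : F.IsHomogeneous d) (p q : Fin 3 → ℂ)
    (hli : LinearIndependent ℂ ![p, q]) (h0 : MvPolynomial.aeval p F = 0) (hq : gr F p q = 0) (r : ℂ)
    (h1 : (lp F q p).eval r = 0) (h2 : (derivative (lp F q p)).eval r = 0) :
    LinearIndependent ℂ ![p, q + r • p] ∧ ContactLE F p (q + r • p) 2 ∧ ContactLE F (q + r • p) p 2 := by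
  rw [lp_eval] at h1
  rw [lp_eval_derivative] at h2
  refine ⟨li_add hli r, (contact_iff _ _ _).mpr ⟨h0, ?_⟩, (contact_iff _ _ _).mpr ⟨h1, h2⟩⟩
  rw [gr_add, gr_smul, hq, gr_self hF, h0]; simp

theorem DD_root {k : ℕ} {F : Form} (hF : F.IsHomogeneous (k+3)) (hG : Good (k+3) F) (hk : k ≠ 0) (u p : Fin 3 → ℂ)
    (hu : dt u p ≠ 0) (h0 : MvPolynomial.aeval p F = 0) (hD : DD k F u p = 0) :
    ∃ r, (lp F (qu F u p) p).eval r = 0 ∧ (derivative (lp F (qu F u p) p)).eval r = 0 := by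
  have hdeg := natDegree_qu (by omega) hF u p h0
  have hli := li_qu hF hG.toSmooth u p hu h0
  rcases Disc_eq_zero k _ hdeg hD with h | ⟨h1, h2⟩
  · exact h
  · exfalso
    apply hG.ga _ _ hli
    rw [← lp_eq_linePoly]
    have : (lp F (qu F u p) p).natDegree ≤ k - 1 := by
      rw [natDegree_le_iff_coeff_eq_zero]
      intro N hN
      by_cases e1 : N = k
      · rw [e1, h1]
      by_cases e2 : N = k+1
      · rw [e2, h2]
      exact coeff_eq_zero_of_natDegree_lt (lt_of_le_of_lt hdeg (by omega))
    omega

theorem T_iff {k : ℕ} {F : Form} (hF : F.IsHomogeneous (k+3)) (hG : Good (k+3) F) (hk : k ≠ 0) (u p : Fin 3 → ℂ)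
    (hu : dt u p ≠ 0) (h0 : MvPolynomial.aeval p F = 0) : DD k F u p = 0 ↔ IsT F p := by
  have hli := li_qu hF hG.toSmooth u p hu h0
  constructor
  · intro h
    obtain ⟨r, h1, h2⟩ := DD_root hF hG hk u p hu h0 h
    exact ⟨_, root_T hF p _ hli h0 (gr_qu F u p) r h1 h2⟩
  · rintro ⟨w, hw, h1, h2⟩
    obtain ⟨α, r, hα, -, a, b⟩ := T_root hF hG.toSmooth p _ hli (gr_qu F u p) w hw h1 h2
    exact Disc_of_double k hk _ (natDegree_qu (by omega) hF u p h0) r a b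

theorem Disc_lp {k : ℕ} {F : Form} (hF : F.IsHomogeneous (k+3)) (p q : Fin 3 → ℂ)
    (h0 : MvPolynomial.aeval p F = 0) (hq : gr F p q = 0) (α β γ : ℂ) (hα : α ≠ 0) (hγ : γ ≠ 0) :
    Disc k (lp F (α • q + β • p) (γ • p)) * α^(k*(k+1)) = α^(2*(k+3)*k) * γ^(k*(k+1)) * Disc k (lp F q p) := by
  have e : lp F (α • q + β • p) (γ • p) = C (α^(k+3)) * (lp F q p).comp (C (γ/α) * X + C (β/α)) := by
    have := lp_comp F q p (γ/α) (β/α)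
    rw [show (C (γ/α) * X + C (β/α) : ℂ[X]) = C (β/α) + X * C (γ/α) by ring, this, ← lp_smul hF]
    congr 1
    · rw [smul_add, smul_smul, mul_div_cancel₀ _ hα]
    · rw [smul_smul, mul_div_cancel₀ _ hα]
  rw [e, Disc_comp k _ (natDegree_two (by omega) hF p q h0 hq) _ _ _ (div_ne_zero hγ hα)]
  rw [div_pow]
  field_simp
  ring

theorem DD_compare {k : ℕ} {F : Form} (hF : F.IsHomogeneous (k+3)) (p u u' : Fin 3 → ℂ)
    (h0 : MvPolynomial.aeval p F = 0) (hu : dt u p ≠ 0) (hu' : dt u' p ≠ 0) :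
    DD k F u p * (dt u' p)^(k*(k+5)) = DD k F u' p * (dt u p)^(k*(k+5)) := by
  have hnp : dt (nb F p) p = 0 := by rw [← gr_eq_dt, gr_self hF, h0, mul_zero]
  have key : dt u' p • qu F u p + (0:ℂ) • p = dt u p • qu F u' p + (dt (nb F p) (cr u u')) • p := by
    unfold dt at *
    funext i
    fin_cases i <;> simp [qu, cr]
    · linear_combination (-(u 1 * u' 2 - u 2 * u' 1)) * hnp
    · linear_combination (-(u 2 * u' 0 - u 0 * u' 2)) * hnp
    · linear_combination (-(u 0 * u' 1 - u 1 * u' 0)) * hnp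
  have e1 := Disc_lp hF p (qu F u p) h0 (gr_qu F u p) (dt u' p) 0 1 hu' one_ne_zero
  have e2 := Disc_lp hF p (qu F u' p) h0 (gr_qu F u' p) (dt u p) (dt (nb F p) (cr u u')) 1 hu one_ne_zero
  rw [key] at e1
  have hx : 2*(k+3)*k = k*(k+5) + k*(k+1) := by ring
  rw [hx, pow_add, one_pow, mul_one] at e1 e2
  change _ = _ * DD k F u p at e1
  change _ = _ * DD k F u' p at e2
  generalize Disc k (lp F (dt u p • qu F u' p + dt (nb F p) (cr u u') • p) ((1:ℂ) • p)) = Z at e1 e2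
  have n1 : dt u' p ^ (k*(k+1)) ≠ 0 := pow_ne_zero _ hu'
  have n2 : dt u p ^ (k*(k+1)) ≠ 0 := pow_ne_zero _ hu
  have f1 : Z = dt u' p ^ (k*(k+5)) * DD k F u p := by
    apply mul_right_cancel₀ n1; rw [e1]; ring
  have f2 : Z = dt u p ^ (k*(k+5)) * DD k F u' p := by
    apply mul_right_cancel₀ n2; rw [e2]; ring
  rw [mul_comm, ← f1, f2, mul_comm]

theorem DD_scale {k : ℕ} {F : Form} (hF : F.IsHomogeneous (k+3)) (p u : Fin 3 → ℂ)
    (h0 : MvPolynomial.aeval p F = 0) (κ : ℂ) (hκ : κ ≠ 0) :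
    DD k F u (κ • p) = κ^(k*(k^2+8*k+11)) * DD k F u p := by
  have hq : qu F u (κ • p) = κ^(k+2) • qu F u p + (0:ℂ) • p := by
    have : nb F (κ • p) = κ^(k+2) • nb F p := by
      funext i; simp [nb, aeval_pderiv_smul hF]
    funext i
    fin_cases i <;> simp [qu, cr, this] <;> ring
  have e := Disc_lp hF p (qu F u p) h0 (gr_qu F u p) (κ^(k+2)) 0 κ (pow_ne_zero _ hκ) hκ
  rw [← hq] at e
  apply mul_right_cancel₀ (pow_ne_zero (k*(k+1)) (pow_ne_zero (k+2) hκ))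
  refine e.trans ?_
  change _ * DD k F u p = _
  ring

end Bit

namespace Bit
open Polynomial

abbrev p0 (p : Fin 3 → DualNumber ℂ) : Fin 3 → ℂ := fun i => (p i).fst
abbrev p1 (p : Fin 3 → DualNumber ℂ) : Fin 3 → ℂ := fun i => (p i).snd

theorem gr_algebraMap (F : Form) (v w : Fin 3 → ℂ) {A : Type*} [CommRing A] [Algebra ℂ A] :
    gr F (fun i => algebraMap ℂ A (v i)) (fun i => algebraMap ℂ A (w i)) = algebraMap ℂ A (gr F v w) := by
  simp only [gr, map_sum, map_mul]
  refine Finset.sum_congr rfl fun i _ => ?_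
  congr 1
  exact MvPolynomial.aeval_algebraMap_apply A v _

theorem aeval_dual (F : Form) (p : Fin 3 → DualNumber ℂ) :
    MvPolynomial.aeval p F = TrivSqZeroExt.inl (MvPolynomial.aeval (p0 p) F) + TrivSqZeroExt.inr (gr F (p0 p) (p1 p)) := by
  have hp : p = (fun i => algebraMap ℂ (DualNumber ℂ) (p0 p i)) + (DualNumber.eps : DualNumber ℂ) • (fun i => algebraMap ℂ (DualNumber ℂ) (p1 p i)) := by
    funext i
    simp only [Pi.add_apply, Pi.smul_apply, smul_eq_mul, TrivSqZeroExt.algebraMap_eq_inl, DualNumber.eps]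
    ext <;> simp
  conv_lhs => rw [hp]
  rw [aeval_add_eps _ _ _ _ (by simp), gr_algebraMap]
  have : (MvPolynomial.aeval fun i => algebraMap ℂ (DualNumber ℂ) (p0 p i)) F = algebraMap ℂ (DualNumber ℂ) (MvPolynomial.aeval (p0 p) F) :=
    MvPolynomial.aeval_algebraMap_apply _ (p0 p) _
  rw [this]
  simp only [TrivSqZeroExt.algebraMap_eq_inl, DualNumber.eps]
  ext <;> simp

theorem aeval_dual_fst (F : Form) (p : Fin 3 → DualNumber ℂ) :
    (MvPolynomial.aeval p F).fst = MvPolynomial.aeval (p0 p) F := by rw [aeval_dual]; simp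
theorem aeval_dual_snd (F : Form) (p : Fin 3 → DualNumber ℂ) :
    (MvPolynomial.aeval p F).snd = gr F (p0 p) (p1 p) := by rw [aeval_dual]; simp

theorem map_fst_lp (F : Form) (v w : Fin 3 → DualNumber ℂ) :
    (lp F v w).map fstR = lp F (p0 v) (p0 w) := by
  have := lp_map (TrivSqZeroExt.fstHom ℂ ℂ ℂ) F v w
  exact this

theorem p0_qu (F : Form) (u : Fin 3 → ℂ) (p : Fin 3 → DualNumber ℂ) : p0 (qu F u p) = qu F u (p0 p) :=
  map_qu (TrivSqZeroExt.fstHom ℂ ℂ ℂ) F u p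

theorem fst_DD (k : ℕ) (F : Form) (u : Fin 3 → ℂ) (p : Fin 3 → DualNumber ℂ) :
    (DD k F u p).fst = DD k F u (p0 p) := map_DD (TrivSqZeroExt.fstHom ℂ ℂ ℂ) k F u p

theorem sq_dvd_of_root {f : ℂ[X]} {r : ℂ} (h0 : f.eval r = 0) (h1 : (derivative f).eval r = 0) : (X - C r)^2 ∣ f := by
  obtain ⟨g, rfl⟩ := dvd_iff_isRoot.mpr h0
  rw [derivative_mul] at h1
  simp at h1
  obtain ⟨h, rfl⟩ := dvd_iff_isRoot.mpr h1
  exact ⟨h, by ring⟩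

theorem double_unique {k : ℕ} {F : Form} (hF : F.IsHomogeneous (k+3)) (hG : Good (k+3) F) (p q : Fin 3 → ℂ)
    (hli : LinearIndependent ℂ ![p, q]) (h0 : MvPolynomial.aeval p F = 0) (hq : gr F p q = 0) (r s : ℂ)
    (hr0 : (lp F q p).eval r = 0) (hr1 : (derivative (lp F q p)).eval r = 0)
    (hs0 : (lp F q p).eval s = 0) (hs1 : (derivative (lp F q p)).eval s = 0) : s = r := by
  by_contra hne
  apply hG.gc p q hli r s
  · have := natDegree_two (by omega) hF p q h0 hq
    rw [← lp_eq_linePoly]; omega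
  · rw [← lp_eq_linePoly]
    apply IsCoprime.mul_dvd
    · apply IsCoprime.pow
      exact isCoprime_X_sub_C_of_isUnit_sub (sub_ne_zero.mpr (Ne.symm hne)).isUnit
    · exact sq_dvd_of_root hr0 hr1
    · exact sq_dvd_of_root hs0 hs1

theorem double_not_triple {k : ℕ} {F : Form} (hF : F.IsHomogeneous (k+3)) (hG : Good (k+3) F) (p q : Fin 3 → ℂ)
    (hli : LinearIndependent ℂ ![p, q]) (h0 : MvPolynomial.aeval p F = 0) (hq : gr F p q = 0) (r : ℂ)
    (hr0 : (lp F q p).eval r = 0) (hr1 : (derivative (lp F q p)).eval r = 0) :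
    (derivative (derivative (lp F q p))).eval r ≠ 0 := by
  intro hr2
  obtain ⟨hl, c1, c2⟩ := root_T hF p q hli h0 hq r hr0 hr1
  rw [contact_iff] at c1 c2
  set w := q + r • p with hw
  have e : lp F w p = (lp F q p).comp (X + C r) := by
    have := lp_comp F q p 1 r
    rw [one_smul] at this
    rw [hw, ← this, C_1, mul_one, add_comm X]
  have t2 : (lp F w p).coeff 2 = 0 := by
    have h : 2 * (lp F w p).coeff 2 = 0 := by
      have : (derivative (derivative (lp F w p))).eval 0 = 0 := by
        rw [e]; simp [derivative_comp, hr2]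
      rw [← coeff_zero_eq_eval_zero, coeff_derivative, coeff_derivative] at this
      norm_num at this
      simpa using this
    simpa using h
  apply hG.gb w p (li_swap hl) 0
  · rw [← lp_eq_linePoly]
    have : (lp F p w).natDegree ≤ k := by
      rw [natDegree_le_iff_coeff_eq_zero]
      intro N hN
      rcases Nat.lt_or_ge (k+3) N with h | h
      · exact coeff_eq_zero_of_natDegree_lt ((lp_natDegree hF p w).trans_lt h)
      · obtain ⟨i, rfl, hi⟩ : ∃ i, N = k + 3 - i ∧ i < 3 := ⟨k+3-N, by omega, by omega⟩
        rw [lp_coeff_swap hF p w i (by omega)]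
        interval_cases i
        · rw [lp_coeff_zero, c2.1]
        · rw [lp_coeff_one, c2.2]
        · exact t2
    omega
  · rw [C_0, sub_zero]
    exact (contact_iff F p w).mpr c1

theorem double_top {k : ℕ} {F : Form} (hF : F.IsHomogeneous (k+3)) (hG : Good (k+3) F) (p q : Fin 3 → ℂ)
    (hli : LinearIndependent ℂ ![p, q]) (h0 : MvPolynomial.aeval p F = 0) (hq : gr F p q = 0) (r : ℂ)
    (hr0 : (lp F q p).eval r = 0) (hr1 : (derivative (lp F q p)).eval r = 0) :
    (lp F q p).coeff (k+1) ≠ 0 := by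
  intro hc
  apply hG.gb p q hli r
  · rw [← lp_eq_linePoly]
    have h1 := natDegree_two (by omega) hF p q h0 hq
    have : (lp F q p).natDegree ≤ k := by
      rw [natDegree_le_iff_coeff_eq_zero]
      intro N hN
      by_cases e2 : N = k+1
      · rw [e2, hc]
      exact coeff_eq_zero_of_natDegree_lt (lt_of_le_of_lt h1 (by omega))
    omega
  · rw [← lp_eq_linePoly]
    exact sq_dvd_of_root hr0 hr1

theorem transversal {k : ℕ} {F : Form} (hF : F.IsHomogeneous (k+3)) (hG : Good (k+3) F) (hk : k ≠ 0) (u : Fin 3 → ℂ)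
    (p : Fin 3 → DualNumber ℂ) (hu : dt u (p0 p) ≠ 0) (hu1 : dt u (p1 p) = 0) (hp1 : p1 p ≠ 0)
    (hFp : MvPolynomial.aeval p F = 0) : DD k F u p ≠ 0 := by
  intro hD
  have hF0 : MvPolynomial.aeval (p0 p) F = 0 := by rw [← aeval_dual_fst, hFp]; simp
  have hF1 : gr F (p0 p) (p1 p) = 0 := by rw [← aeval_dual_snd, hFp]; simp
  have hD0 : DD k F u (p0 p) = 0 := by rw [← fst_DD, hD]; simp
  obtain ⟨r, hr0, hr1⟩ := DD_root hF hG hk u (p0 p) hu hF0 hD0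
  have hli := li_qu hF hG.toSmooth u (p0 p) hu hF0
  have hgq := gr_qu F u (p0 p)
  set P := p0 p with hP
  set q := qu F u P with hq
  have hPne : P ≠ 0 := hli.ne_zero 0
  have hqne : q ≠ 0 := hli.ne_zero 1
  have htop := double_top hF hG P q hli hF0 hgq r hr0 hr1
  have hmap : (lp F (qu F u p) p).map fstR = lp F q P := by rw [map_fst_lp, p0_qu]
  obtain ⟨s, hsr, hs⟩ := Disc_dual k hk (lp F (qu F u p) p) (natDegree_qu (by omega) hF u p hFp)
    (by rw [hmap]; exact htop) r (by rw [hmap]; exact hr0) (by rw [hmap]; exact hr1)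
    (by rw [hmap]; exact double_not_triple hF hG P q hli hF0 hgq r hr0 hr1)
    (by rw [hmap]; intro x hx0 hx1; exact double_unique hF hG P q hli hF0 hgq r x hr0 hr1 hx0 hx1)
  have hs := hs hD
  rw [lp_eval] at hs
  have hs := congrArg TrivSqZeroExt.snd hs
  rw [aeval_dual_snd, TrivSqZeroExt.snd_zero] at hs
  set w := q + r • P with hw
  have hw0 : p0 (qu F u p + s • p) = w := by
    rw [hw, hq, hP, ← p0_qu]
    funext i
    change (qu F u p i + s * p i).fst = (qu F u p i).fst + r * (p i).fst
    rw [TrivSqZeroExt.fst_add, TrivSqZeroExt.fst_mul, hsr]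
  set q1 := p1 (qu F u p) with hq1
  have hw1 : p1 (qu F u p + s • p) = q1 + r • p1 p + s.snd • P := by
    funext i
    change (qu F u p i + s * p i).snd = (qu F u p i).snd + r * (p i).snd + s.snd * (p i).fst
    rw [TrivSqZeroExt.snd_add, TrivSqZeroExt.snd_mul, hsr]
    simp
    ring
  rw [hw0, hw1] at hs
  obtain ⟨hl, c1, c2⟩ := root_T hF P q hli hF0 hgq r hr0 hr1
  rw [contact_iff] at c1 c2
  rw [← hw] at c1 c2 hl
  have hwne : w ≠ 0 := hl.ne_zero 1
  obtain ⟨c, hc⟩ := hG.toSmooth.exists P hPne hF0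
  have hgPP : gr F P P = 0 := by rw [gr_self hF, hF0, mul_zero]
  have hgww : gr F w w = 0 := by rw [gr_self hF, c2.1, mul_zero]
  have prop : ∀ x, gr F w x = (gr F P x / gr F P c) * gr F w c := by
    intro x
    obtain ⟨α, β, e⟩ := span3 (grL F P) P w c hgPP c1.2 hl hc x
    have e' : x = α • P + β • w + (gr F P x / gr F P c) • c := e
    conv_lhs => rw [e']
    rw [gr_add, gr_add, gr_smul, gr_smul, gr_smul, c2.2, hgww]
    ring
  have hwc : gr F w c ≠ 0 := by
    intro h
    obtain ⟨x, hx⟩ := hG.toSmooth.exists w hwne c2.1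
    rw [prop x, h, mul_zero] at hx
    exact hx rfl
  rw [prop] at hs
  have hs := (mul_eq_zero.mp hs).resolve_right hwc
  have hs := (div_eq_zero_iff.mp hs).resolve_right hc
  rw [gr_add, gr_add, gr_smul, gr_smul, hF1, hgPP, mul_zero, mul_zero, add_zero, add_zero] at hs
  -- p1 is proportional to q
  obtain ⟨κ, hκ⟩ : ∃ κ : ℂ, p1 p = κ • q := by
    apply cr_eq_zero hqne
    rw [gr_eq_dt] at hF1
    unfold dt at hF1 hu1
    rw [hq]
    funext i
    fin_cases i <;> simp [qu, cr]
    · linear_combination (u 0) * hF1 - (nb F P 0) * hu1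
    · linear_combination (u 1) * hF1 - (nb F P 1) * hu1
    · linear_combination (u 2) * hF1 - (nb F P 2) * hu1
  have hκ0 : κ ≠ 0 := by rintro rfl; rw [zero_smul] at hκ; exact hp1 hκ
  have hz := congrArg TrivSqZeroExt.snd (gr_qu F u p)
  have hz2 : Bit.hs F P (p1 p) q + gr F P q1 = 0 := by
    rw [gr] at hz
    simp only [TrivSqZeroExt.snd_sum, TrivSqZeroExt.snd_mul, TrivSqZeroExt.snd_zero, aeval_dual_fst, aeval_dual_snd, smul_eq_mul, MulOpposite.smul_eq_mul_unop, MulOpposite.unop_op] at hz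
    rw [Finset.sum_add_distrib, add_comm] at hz
    rw [← hz]
    congr 1
    · simp only [Bit.hs]
      refine Finset.sum_congr rfl fun i _ => ?_
      rw [hq, hP, ← p0_qu]
  rw [hs, add_zero, hκ] at hz2
  have hlin : Bit.hs F P (κ • q) q = κ * Bit.hs F P q q := by
    simp only [Bit.hs, gr_smul, Finset.mul_sum, mul_assoc]
  rw [hlin, ← lp_coeff_two, ← lp_coeff_swap hF q P 2 (by omega)] at hz2
  simp [hκ0] at hz2
  exact htop hz2

end Bit

namespace Bit
open Polynomial

abbrev ey {A : Type*} [CommRing A] : Fin 3 → A := ![0, 1, 0]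
abbrev ez {A : Type*} [CommRing A] : Fin 3 → A := ![0, 0, 1]

def pt (b : Fin 3 → ℂ[X]) : Fin 3 → ℂ[X][X] := fun i => C (b i) + X * C (ey i)
def ff (F : Form) (b : Fin 3 → ℂ[X]) : ℂ[X][X] := lp F b ey
def nrm (F : Form) (d : ℕ) (b : Fin 3 → ℂ[X]) (g : ℂ[X][X]) : ℂ[X] := resultant (ff F b) g d g.natDegree

def ev {R : Type*} [CommRing R] [Algebra ℂ R] (φ : ℂ[X] →ₐ[ℂ] R) (η : R) : ℂ[X][X] →ₐ[ℂ] R :=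
  ((Polynomial.aeval (R := R) η).restrictScalars ℂ).comp (Polynomial.mapAlgHom φ)

section
variable {R : Type*} [CommRing R] [Algebra ℂ R] (φ : ℂ[X] →ₐ[ℂ] R) (η : R)

theorem ev_apply (g : ℂ[X][X]) : ev φ η g = (g.map (φ : ℂ[X] →+* R)).eval η := by
  simp [ev, coe_aeval_eq_eval]

theorem ev_pt (b : Fin 3 → ℂ[X]) : (fun i => ev φ η (pt b i)) = (fun i => φ (b i)) + η • ey := by
  funext i
  rw [ev_apply]
  fin_cases i <;> simp [pt]

theorem ev_DD (k : ℕ) (F : Form) (u : Fin 3 → ℂ) (b : Fin 3 → ℂ[X]) :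
    ev φ η (DD k F u (pt b)) = DD k F u ((fun i => φ (b i)) + η • ey) := by
  rw [map_DD, ev_pt]

theorem map_ff (F : Form) (b : Fin 3 → ℂ[X]) : (ff F b).map (φ : ℂ[X] →+* R) = lp F (fun i => φ (b i)) ey := by
  rw [ff, lp_map]
  congr 1
  funext i; fin_cases i <;> simp

theorem ev_ff (F : Form) (b : Fin 3 → ℂ[X]) : ev φ η (ff F b) = MvPolynomial.aeval ((fun i => φ (b i)) + η • ey) F := by
  rw [ev_apply, map_ff, lp_eval]
end

section

theorem lp_ey_monic {d : ℕ} {F : Form} (hF : F.IsHomogeneous d) (h1 : MvPolynomial.aeval (ey : Fin 3 → ℂ) F = 1) {R : Type*} [CommRing R] [Algebra ℂ R] [Nontrivial R] (v : Fin 3 → R) :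
    (lp F v ey).Monic ∧ (lp F v ey).natDegree = d := by
  have hc : (lp F v ey).coeff d = 1 := by
    rw [lp_coeff_top hF]
    have : (ey : Fin 3 → R) = fun i => algebraMap ℂ R (ey i) := by
      funext i; fin_cases i <;> simp
    rw [this]
    exact (MvPolynomial.aeval_algebraMap_apply R (ey : Fin 3 → ℂ) F).trans (by rw [h1, map_one])
  have hd : (lp F v ey).natDegree = d :=
    natDegree_eq_of_le_of_coeff_ne_zero (lp_natDegree hF _ _) (by rw [hc]; exact one_ne_zero)
  exact ⟨by rw [Monic, leadingCoeff, hd, hc], hd⟩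

theorem nrm_eval {d : ℕ} {F : Form} (hF : F.IsHomogeneous d) (h1 : MvPolynomial.aeval (ey : Fin 3 → ℂ) F = 1) (b : Fin 3 → ℂ[X]) (g : ℂ[X][X]) (x : ℂ) :
    (nrm F d b g).eval x =
      ((lp F (fun i => (b i).eval x) ey).roots.map (fun η => ev (Polynomial.aeval x) η g)).prod := by
  have e : (nrm F d b g).eval x = ((Polynomial.aeval x : ℂ[X] →ₐ[ℂ] ℂ) : ℂ[X] →+* ℂ) (nrm F d b g) := by
    simp [coe_aeval_eq_eval]
  rw [e, nrm, ← resultant_map_map, map_ff]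
  simp only [coe_aeval_eq_eval]
  obtain ⟨hm, hd⟩ := lp_ey_monic hF h1 (fun i => (b i).eval x)
  have := resultant_eq_prod_eval (lp F (fun i => (b i).eval x) ey)
    (g.map ((Polynomial.aeval x : ℂ[X] →ₐ[ℂ] ℂ) : ℂ[X] →+* ℂ)) g.natDegree natDegree_map_le (IsAlgClosed.splits _)
  rw [hd, hm.leadingCoeff, one_pow, one_mul] at this
  rw [this]
  congr 1

theorem nrm_DD_eval {d : ℕ} {F : Form} (hF : F.IsHomogeneous d) (h1 : MvPolynomial.aeval (ey : Fin 3 → ℂ) F = 1) (k : ℕ) (u : Fin 3 → ℂ) (b : Fin 3 → ℂ[X]) (x : ℂ) :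
    (nrm F d b (DD k F u (pt b))).eval x =
      ((lp F (fun i => (b i).eval x) ey).roots.map (fun η => DD k F u ((fun i => (b i).eval x) + η • ey))).prod := by
  rw [nrm_eval hF h1]
  refine congrArg Multiset.prod (Multiset.map_congr rfl ?_)
  intro η _
  rw [ev_DD]
  simp [coe_aeval_eq_eval]

theorem lp_roots_mem {d : ℕ} {F : Form} (hF : F.IsHomogeneous d) (h1 : MvPolynomial.aeval (ey : Fin 3 → ℂ) F = 1) (v : Fin 3 → ℂ) (η : ℂ) : η ∈ (lp F v ey).roots ↔ MvPolynomial.aeval (v + η • ey) F = 0 := by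
  rw [mem_roots (lp_ey_monic hF h1 v).1.ne_zero, IsRoot.def, lp_eval]

theorem lp_roots_card {d : ℕ} {F : Form} (hF : F.IsHomogeneous d) (h1 : MvPolynomial.aeval (ey : Fin 3 → ℂ) F = 1) (v : Fin 3 → ℂ) : (lp F v ey).roots.card = d := by
  rw [← (IsAlgClosed.splits _).natDegree_eq_card_roots, (lp_ey_monic hF h1 v).2]

theorem lp_roots_scale {d : ℕ} {F : Form} (hF : F.IsHomogeneous d) (h1 : MvPolynomial.aeval (ey : Fin 3 → ℂ) F = 1) (v : Fin 3 → ℂ) (x : ℂ) (hx : x ≠ 0) :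
    (lp F v ey).roots = (lp F (x • v) ey).roots.map (fun η => x⁻¹ * η) := by
  have e : lp F (x • v) ey = C (x^d) * (lp F v ey).comp (C x⁻¹ * X + C 0) := by
    have h := lp_comp F v ey x⁻¹ 0
    rw [show (C x⁻¹ * X + C 0 : ℂ[X]) = C 0 + X * C x⁻¹ by ring, h, ← lp_smul hF]
    congr 1
    · simp
    · rw [smul_smul, mul_inv_cancel₀ hx, one_smul]
  rw [e, roots_C_mul _ (pow_ne_zero _ hx)]
  have := map_roots_comp_C_mul_X_add_C (lp F v ey) x⁻¹ 0 (inv_ne_zero hx).isUnit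
  simp only [add_zero] at this
  exact this.symm

end

abbrev bz : Fin 3 → ℂ[X] := ![X, 0, 1]
abbrev bx : Fin 3 → ℂ[X] := ![1, 0, X]

theorem bz_eval (x : ℂ) : (fun i => (bz i).eval x) = ![x, 0, 1] := by funext i; fin_cases i <;> simp
theorem bx_eval (x : ℂ) : (fun i => (bx i).eval x) = ![1, 0, x] := by funext i; fin_cases i <;> simp

theorem pt_z (x η : ℂ) : (![x,0,1] : Fin 3 → ℂ) + η • ey = ![x, η, 1] := by
  funext i; fin_cases i <;> simp
theorem pt_x (x η : ℂ) : (![1,0,x] : Fin 3 → ℂ) + η • ey = ![1, η, x] := by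
  funext i; fin_cases i <;> simp
def nu (k : ℕ) (F : Form) := nrm F (k+3) bz (DD k F ez (pt bz))
def nu' (k : ℕ) (F : Form) := nrm F (k+3) bx (DD k F ez (pt bx))
def mu (k : ℕ) (F : Form) := nrm F (k+3) bx (DD k F ey (pt bx))
def cc (k : ℕ) (F : Form) := nrm F (k+3) bx X

section

theorem nu_eval {k : ℕ} {F : Form} (hF : F.IsHomogeneous (k+3)) (h1 : MvPolynomial.aeval (ey : Fin 3 → ℂ) F = 1) (x : ℂ) : (nu k F).eval x = ((lp F ![x,0,1] ey).roots.map (fun η => DD k F ez ![x, η, 1])).prod := by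
  rw [nu, nrm_DD_eval hF h1, bz_eval]
  simp only [pt_z]
theorem nu'_eval {k : ℕ} {F : Form} (hF : F.IsHomogeneous (k+3)) (h1 : MvPolynomial.aeval (ey : Fin 3 → ℂ) F = 1) (x : ℂ) : (nu' k F).eval x = ((lp F ![1,0,x] ey).roots.map (fun η => DD k F ez ![1, η, x])).prod := by
  rw [nu', nrm_DD_eval hF h1, bx_eval]
  simp only [pt_x]
theorem mu_eval {k : ℕ} {F : Form} (hF : F.IsHomogeneous (k+3)) (h1 : MvPolynomial.aeval (ey : Fin 3 → ℂ) F = 1) (x : ℂ) : (mu k F).eval x = ((lp F ![1,0,x] ey).roots.map (fun η => DD k F ey ![1, η, x])).prod := by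
  rw [mu, nrm_DD_eval hF h1, bx_eval]
  simp only [pt_x]
theorem cc_eval {k : ℕ} {F : Form} (hF : F.IsHomogeneous (k+3)) (h1 : MvPolynomial.aeval (ey : Fin 3 → ℂ) F = 1) (x : ℂ) : (cc k F).eval x = (lp F ![1,0,x] ey).roots.prod := by
  rw [cc, nrm_eval hF h1, bx_eval]
  congr 1
  conv_rhs => rw [← Multiset.map_id (lp F ![1,0,x] ey).roots]
  apply Multiset.map_congr rfl; intro η _; simp [ev_apply]

theorem nu_scale {k : ℕ} {F : Form} (hF : F.IsHomogeneous (k+3)) (h1 : MvPolynomial.aeval (ey : Fin 3 → ℂ) F = 1) (x : ℂ) (hx : x ≠ 0) :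
    (nu k F).eval x = x^((k+3)*(k*(k^2+8*k+11))) * (nu' k F).eval x⁻¹ := by
  rw [nu_eval hF h1, nu'_eval hF h1, lp_roots_scale hF h1 ![1,0,x⁻¹] x hx, Multiset.map_map]
  have e : x • ![1, 0, x⁻¹] = ![x, 0, 1] := by
    funext i; fin_cases i <;> simp [hx]
  rw [e]
  have hcard := lp_roots_card hF h1 ![x,0,1]
  conv_rhs => rw [← hcard]
  rw [mul_comm (Multiset.card _), pow_mul, ← Multiset.prod_replicate, ← Multiset.map_const', ← Multiset.prod_map_mul]
  refine congrArg Multiset.prod (Multiset.map_congr rfl ?_)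
  intro η hη
  rw [lp_roots_mem hF h1] at hη
  have e2 : ![1, x⁻¹ * η, x⁻¹] = x⁻¹ • ![x, η, 1] := by
    funext i; fin_cases i <;> simp [hx]
  have e3 : (![x,0,1] : Fin 3 → ℂ) + η • ey = ![x, η, 1] := by
    funext i; fin_cases i <;> simp
  rw [e3] at hη
  simp only [Function.comp]
  rw [e2, DD_scale hF _ _ hη _ (inv_ne_zero hx), ← mul_assoc, ← mul_pow, mul_inv_cancel₀ hx, one_pow, one_mul]

theorem nu'_mu {k : ℕ} {F : Form} (hF : F.IsHomogeneous (k+3)) (h1 : MvPolynomial.aeval (ey : Fin 3 → ℂ) F = 1) : nu' k F * (cc k F)^(k*(k+5)) = mu k F * X^((k+3)*(k*(k+5))) ∨ cc k F = 0 := by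
  by_cases hc : cc k F = 0
  · exact Or.inr hc
  left
  have : (nu' k F * (cc k F)^(k*(k+5)) - mu k F * X^((k+3)*(k*(k+5)))) * (X * cc k F) = 0 := by
    apply Polynomial.funext
    intro x
    by_cases hx : x = 0
    · simp [hx]
    by_cases hcx : (cc k F).eval x = 0
    · simp [hcx]
    have key : (nu' k F).eval x * ((cc k F).eval x)^(k*(k+5)) = (mu k F).eval x * x^((k+3)*(k*(k+5))) := by
      rw [cc_eval hF h1] at *
      rw [nu'_eval hF h1, mu_eval hF h1]
      have hcard := lp_roots_card hF h1 ![1,0,x]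
      rw [← hcard]
      have hpw : ((lp F ![1,0,x] ey).roots.prod)^(k*(k+5)) = ((lp F ![1,0,x] ey).roots.map (fun η => η^(k*(k+5)))).prod := by
        rw [Multiset.prod_map_pow, Multiset.map_id']
      rw [mul_comm (Multiset.card _) (k*(k+5)), pow_mul x, ← Multiset.prod_replicate (Multiset.card _), ← Multiset.map_const', hpw, ← Multiset.prod_map_mul, ← Multiset.prod_map_mul]
      refine congrArg Multiset.prod (Multiset.map_congr rfl ?_)
      intro η hη
      have hη0 : η ≠ 0 := by
        rintro rfl
        exact hcx (Multiset.prod_eq_zero hη)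
      rw [lp_roots_mem hF h1] at hη
      have e3 : (![1,0,x] : Fin 3 → ℂ) + η • ey = ![1, η, x] := by
        funext i; fin_cases i <;> simp
      rw [e3] at hη
      have := DD_compare hF ![1,η,x] ez ey hη (by simp [dt, hx]) (by simp [dt, hη0])
      simpa [dt] using this
    simp [key]
  rcases mul_eq_zero.mp this with h | h
  · exact sub_eq_zero.mp h
  · exfalso
    rcases mul_eq_zero.mp h with h | h
    · exact X_ne_zero h
    · exact hc h

end
end Bit

namespace Bit
open Polynomial

theorem aeval_dual1 (p : ℂ[X]) (x a : ℂ) :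
    Polynomial.aeval (TrivSqZeroExt.inl x + TrivSqZeroExt.inr a : DualNumber ℂ) p
      = TrivSqZeroExt.inl (p.eval x) + TrivSqZeroExt.inr (a * (derivative p).eval x) := by
  rw [Polynomial.aeval_add_of_sq_eq_zero]
  · have e : ∀ q : ℂ[X], Polynomial.aeval (TrivSqZeroExt.inl x : DualNumber ℂ) q = TrivSqZeroExt.inl (q.eval x) := by
      intro q
      exact Polynomial.aeval_algebraMap_apply (DualNumber ℂ) x q
    rw [e, e, mul_comm a]
    rw [TrivSqZeroExt.inl_mul_inr, smul_eq_mul]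
  · rw [pow_two, TrivSqZeroExt.inr_mul_inr]

theorem ev_dual (h : ℂ[X][X]) (x η : ℂ) : ∃ A B : ℂ, ∀ a b : ℂ,
    ev (Polynomial.aeval (TrivSqZeroExt.inl x + TrivSqZeroExt.inr a : DualNumber ℂ)) (TrivSqZeroExt.inl η + TrivSqZeroExt.inr b) h
      = TrivSqZeroExt.inl (ev (Polynomial.aeval x) η h) + TrivSqZeroExt.inr (a * A + b * B) := by
  induction h using Polynomial.induction_on' with
  | add p q hp hq =>
    obtain ⟨A, B, h1⟩ := hp
    obtain ⟨A', B', h2⟩ := hq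
    refine ⟨A + A', B + B', fun a b => ?_⟩
    rw [map_add, h1, h2, map_add]
    ext
    · simp
    · simp; ring
  | monomial n p =>
    refine ⟨(derivative p).eval x * η^n, p.eval x * (derivative (X^n)).eval η, fun a b => ?_⟩
    have h2 : (TrivSqZeroExt.inl η + TrivSqZeroExt.inr b : DualNumber ℂ)^n = TrivSqZeroExt.inl (η^n) + TrivSqZeroExt.inr (b * (derivative (X^n : ℂ[X])).eval η) := by
      have := aeval_dual1 (X^n) η b
      rw [map_pow, aeval_X] at this
      rw [this]; simp
    rw [ev_apply, ev_apply, map_monomial, map_monomial, eval_monomial, eval_monomial, h2]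
    simp only [RingHom.coe_coe]
    rw [aeval_dual1]
    ext
    · simp [coe_aeval_eq_eval]
    · simp; ring

theorem nu_ne_zero {k : ℕ} {F : Form} (hF : F.IsHomogeneous (k+3)) (h1 : MvPolynomial.aeval (ey : Fin 3 → ℂ) F = 1)
    (hG : Good (k+3) F) (hk : k ≠ 0) : nu k F ≠ 0 := by
  intro h0
  rw [nu, nrm] at h0
  set g := DD k F ez (pt bz) with hg
  have hinj := IsFractionRing.injective ℂ[X] (RatFunc ℂ)
  have hm := lp_ey_monic hF h1 bz
  have h2 := congrArg (algebraMap ℂ[X] (RatFunc ℂ)) h0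
  rw [← resultant_map_map, map_zero] at h2
  have hfd : ((ff F bz).map (algebraMap ℂ[X] (RatFunc ℂ))).natDegree = k+3 := by
    rw [natDegree_map_eq_of_injective hinj]; exact hm.2
  have hgd : (g.map (algebraMap ℂ[X] (RatFunc ℂ))).natDegree = g.natDegree := by
    rw [natDegree_map_eq_of_injective hinj]
  have h3 : resultant ((ff F bz).map (algebraMap ℂ[X] (RatFunc ℂ))) (g.map (algebraMap ℂ[X] (RatFunc ℂ))) = 0 := by
    rw [hfd, hgd]; exact h2
  rw [resultant_eq_zero_iff] at h3
  have hnc := h3.2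
  have hmK : ((ff F bz).map (algebraMap ℂ[X] (RatFunc ℂ))).Monic := hm.1.map _
  classical
  rw [← EuclideanDomain.gcd_isUnit_iff] at hnc
  set e := EuclideanDomain.gcd ((ff F bz).map (algebraMap ℂ[X] (RatFunc ℂ))) (g.map (algebraMap ℂ[X] (RatFunc ℂ))) with he
  have hd1 : e ∣ (ff F bz).map (algebraMap ℂ[X] (RatFunc ℂ)) := EuclideanDomain.gcd_dvd_left _ _
  have hd2 : e ∣ g.map (algebraMap ℂ[X] (RatFunc ℂ)) := EuclideanDomain.gcd_dvd_right _ _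
  have he0 : e ≠ 0 := by intro h; rw [h] at hd1; exact hmK.ne_zero (zero_dvd_iff.mp hd1)
  obtain ⟨h, hh⟩ := IsIntegrallyClosed.eq_map_mul_C_of_dvd (RatFunc ℂ) hm.1 hd1
  have hlc : IsUnit (C e.leadingCoeff : (RatFunc ℂ)[X]) := by
    rw [isUnit_C]; exact (leadingCoeff_ne_zero.mpr he0).isUnit
  have hass : Associated (h.map (algebraMap ℂ[X] (RatFunc ℂ))) e := by
    rw [← hh]; exact (associated_mul_unit_right _ _ hlc)
  have hmon : h.Monic := by
    have : (h.map (algebraMap ℂ[X] (RatFunc ℂ))).leadingCoeff = 1 := by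
      have := congrArg leadingCoeff hh
      rw [leadingCoeff_mul, leadingCoeff_C] at this
      exact mul_right_cancel₀ (leadingCoeff_ne_zero.mpr he0) (by rw [this, one_mul])
    rw [leadingCoeff_map_of_injective hinj] at this
    exact hinj (by rw [this, map_one])
  have hhf : h ∣ ff F bz := (map_dvd_map _ hinj hmon).mp (hass.dvd.trans hd1)
  have hhg : h ∣ g := (map_dvd_map _ hinj hmon).mp (hass.dvd.trans hd2)
  have hhd : h.natDegree ≠ 0 := by
    intro hz
    have := hmon.natDegree_eq_zero.mp hz
    rw [this, Polynomial.map_one] at hass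
    exact hnc (hass.isUnit isUnit_one)
  have hroot : ∃ η : ℂ, (h.map ((Polynomial.aeval (0:ℂ) : ℂ[X] →ₐ[ℂ] ℂ) : ℂ[X] →+* ℂ)).eval η = 0 := by
    apply IsAlgClosed.exists_root
    rw [degree_eq_natDegree (hmon.map _).ne_zero, hmon.natDegree_map]
    exact_mod_cast hhd
  obtain ⟨η, hη⟩ := hroot
  rw [← ev_apply] at hη
  obtain ⟨A, B, hAB⟩ := ev_dual h 0 η
  obtain ⟨a, b, hab, hz⟩ : ∃ a b : ℂ, (a ≠ 0 ∨ b ≠ 0) ∧ a * A + b * B = 0 := by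
    by_cases hA : A = 0
    · exact ⟨1, 0, Or.inl one_ne_zero, by simp [hA]⟩
    · exact ⟨-B, A, Or.inr hA, by ring⟩
  have hev := hAB a b
  rw [hη, hz] at hev
  set φ : ℂ[X] →ₐ[ℂ] DualNumber ℂ := Polynomial.aeval (TrivSqZeroExt.inl 0 + TrivSqZeroExt.inr a : DualNumber ℂ) with hφ
  set y : DualNumber ℂ := TrivSqZeroExt.inl η + TrivSqZeroExt.inr b with hy
  have hev0 : ev φ y h = 0 := by rw [hev]; simp
  have e1 : ev φ y (ff F bz) = 0 := by
    obtain ⟨c, hc⟩ := hhf; rw [hc, map_mul, hev0, zero_mul]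
  have e2 : ev φ y g = 0 := by
    obtain ⟨c, hc⟩ := hhg; rw [hc, map_mul, hev0, zero_mul]
  rw [ev_ff] at e1
  rw [hg, ev_DD] at e2
  have hx : φ X = TrivSqZeroExt.inr a := by rw [hφ, aeval_X]; simp
  have hP : ((fun i => φ (bz i)) + y • ey : Fin 3 → DualNumber ℂ) = ![TrivSqZeroExt.inr a, y, 1] := by
    funext i; fin_cases i <;> simp [hx]
  rw [hP] at e1 e2
  refine transversal hF hG hk ez _ ?_ ?_ ?_ e1 e2
  · simp [dt, p0]
  · simp [dt, p1]
  · intro hp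
    have q0 := congrFun hp 0
    have q1 := congrFun hp 1
    simp [p1, hy] at q0 q1
    rcases hab with h | h
    · exact h q0
    · exact h q1
end Bit

namespace Bit
open Polynomial

structure Coord (k : ℕ) (F : Form) : Prop where
  hF : F.IsHomogeneous (k+3)
  hG : Good (k+3) F
  hk : k ≠ 0
  h1 : MvPolynomial.aeval (ey : Fin 3 → ℂ) F = 1
  h2 : MvPolynomial.aeval (![1,0,0] : Fin 3 → ℂ) F ≠ 0
  h3 : ∀ p, IsT F p → p 2 ≠ 0
  h4 : ∀ p, IsT F p → gr F p ey ≠ 0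
  h5 : ∀ p p', IsT F p → IsT F p' → p 0 * p' 2 = p' 0 * p 2 → ∃ c : ℂ, p' = c • p

theorem natDegree_of_inv (f ρ : ℂ[X]) (K : ℕ) (h0 : ρ.eval 0 ≠ 0) (h : ∀ x : ℂ, x ≠ 0 → f.eval x = x^K * ρ.eval x⁻¹) :
    f.natDegree = K := by
  have hρ : ρ ≠ 0 := by rintro rfl; simp at h0
  have key : (f * X^ρ.natDegree - X^K * reverse ρ) * X = 0 := by
    apply Polynomial.funext
    intro x
    by_cases hx : x = 0
    · simp [hx]
    letI : Invertible x⁻¹ := invertibleOfNonzero (inv_ne_zero hx)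
    have := eval₂_reverse_mul_pow (RingHom.id ℂ) x⁻¹ ρ
    simp only [invOf_eq_inv, inv_inv, eval₂_id] at this
    have hp : x^ρ.natDegree * (x⁻¹)^ρ.natDegree = 1 := by rw [← mul_pow, mul_inv_cancel₀ hx, one_pow]
    have : f.eval x * x^ρ.natDegree - x^K * (reverse ρ).eval x = 0 := by
      rw [h x hx, ← this]
      linear_combination (x^K * (reverse ρ).eval x) * hp
    simp [this]
  have key2 : f * X^ρ.natDegree = X^K * reverse ρ := by
    rcases mul_eq_zero.mp key with h | h
    · exact sub_eq_zero.mp h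
    · exact absurd h X_ne_zero
  have hf : f ≠ 0 := by
    rintro rfl
    rw [zero_mul] at key2
    have := mul_eq_zero.mp key2.symm
    simp [hρ] at this
  have h3 := congrArg natDegree key2
  have hr : (reverse ρ).natDegree = ρ.natDegree := by
    rw [reverse_natDegree, natTrailingDegree_eq_zero.mpr (Or.inr (by rwa [coeff_zero_eq_eval_zero])), Nat.sub_zero]
  rw [natDegree_mul hf (pow_ne_zero _ X_ne_zero), natDegree_mul (pow_ne_zero _ X_ne_zero) (by simpa using hρ), natDegree_X_pow, natDegree_X_pow, hr] at h3
  omega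


theorem nu_natDegree {k : ℕ} {F : Form} (hC : Coord k F) : (nu k F).natDegree = (k+3)*(k*((k+1)*(k+6))) := by
  have hc : (cc k F).eval 0 ≠ 0 := by
    rw [cc_eval hC.hF hC.h1]
    intro h
    have := Multiset.prod_eq_zero_iff.mp h
    rw [lp_roots_mem hC.hF hC.h1] at this
    exact hC.h2 (by simpa using this)
  have hmu : (mu k F).eval 0 ≠ 0 := by
    rw [mu_eval hC.hF hC.h1]
    intro h
    have := Multiset.prod_eq_zero_iff.mp h
    obtain ⟨η, hη, hD⟩ := Multiset.mem_map.mp this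
    rw [lp_roots_mem hC.hF hC.h1, pt_x] at hη
    have hη0 : η ≠ 0 := by rintro rfl; exact hC.h2 hη
    rw [T_iff hC.hF hC.hG hC.hk _ _ (by simp [dt, hη0]) hη] at hD
    exact hC.h3 _ hD (by simp)
  have hcc0 : cc k F ≠ 0 := by intro h; rw [h] at hc; simp at hc
  have key := (nu'_mu hC.hF hC.h1).resolve_right hcc0
  have hcop : IsCoprime (X^((k+3)*(k*(k+5))) : ℂ[X]) ((cc k F)^(k*(k+5))) := by
    apply IsCoprime.pow
    rw [Irreducible.coprime_iff_not_dvd irreducible_X, X_dvd_iff, coeff_zero_eq_eval_zero]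
    exact hc
  obtain ⟨ρ, hρ⟩ := hcop.dvd_of_dvd_mul_right (Dvd.intro_left _ key.symm)
  have hρ0 : ρ.eval 0 ≠ 0 := by
    intro h
    have : X^((k+3)*(k*(k+5))) * (ρ * (cc k F)^(k*(k+5))) = X^((k+3)*(k*(k+5))) * mu k F := by
      rw [← mul_assoc, ← hρ, key, mul_comm]
    have := mul_left_cancel₀ (pow_ne_zero _ X_ne_zero) this
    apply hmu
    rw [← this]; simp [h]
  apply natDegree_of_inv _ ρ _ hρ0
  intro x hx
  rw [nu_scale hC.hF hC.h1 x hx, hρ]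
  have e : (k+3)*(k*(k^2+8*k+11)) = (k+3)*(k*((k+1)*(k+6))) + (k+3)*(k*(k+5)) := by ring
  rw [e, pow_add]
  simp only [eval_mul, eval_pow, eval_X]
  have hp : x^((k+3)*(k*(k+5))) * (x⁻¹)^((k+3)*(k*(k+5))) = 1 := by rw [← mul_pow, mul_inv_cancel₀ hx, one_pow]
  linear_combination (x^((k+3)*(k*((k+1)*(k+6)))) * ρ.eval x⁻¹) * hp

theorem nu_root_iff {k : ℕ} {F : Form} (hC : Coord k F) (x : ℂ) : (nu k F).eval x = 0 ↔ ∃ η, MvPolynomial.aeval ![x, η, 1] F = 0 ∧ IsT F ![x, η, 1] := by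
  rw [nu_eval hC.hF hC.h1, Multiset.prod_eq_zero_iff, Multiset.mem_map]
  apply exists_congr
  intro η
  rw [lp_roots_mem hC.hF hC.h1, pt_z]
  constructor
  · rintro ⟨h, h'⟩
    exact ⟨h, (T_iff hC.hF hC.hG hC.hk _ _ (by simp [dt]) h).mp h'⟩
  · rintro ⟨h, h'⟩
    exact ⟨h, (T_iff hC.hF hC.hG hC.hk _ _ (by simp [dt]) h).mpr h'⟩

theorem T_unique {k : ℕ} {F : Form} (hC : Coord k F) (x η η' : ℂ) (h : IsT F ![x, η, 1]) (h' : IsT F ![x, η', 1]) : η' = η := by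
  obtain ⟨c, hc⟩ := hC.h5 _ _ h h' (by simp)
  have e2 := congrFun hc 2
  have e1 := congrFun hc 1
  simp at e1 e2
  rw [e1, ← e2, one_mul]

theorem nu_simple {k : ℕ} {F : Form} (hC : Coord k F) (x : ℂ) (h : (nu k F).eval x = 0) : (derivative (nu k F)).eval x ≠ 0 := by
  intro hd
  obtain ⟨η, hη, hT⟩ := (nu_root_iff hC x).mp h
  set ψ : ℂ[X] →ₐ[ℂ] DualNumber ℂ := Polynomial.aeval (TrivSqZeroExt.inl x + TrivSqZeroExt.inr 1 : DualNumber ℂ) with hψ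
  have hz : ψ (nu k F) = 0 := by
    rw [hψ, aeval_dual1, h, hd]; simp
  set g := DD k F ez (pt bz) with hg
  have hz2 : resultant ((ff F bz).map (ψ : ℂ[X] →+* DualNumber ℂ)) (g.map (ψ : ℂ[X] →+* DualNumber ℂ)) (k+3) g.natDegree = 0 := by
    rw [resultant_map_map]; exact hz
  have hψX : ψ X = TrivSqZeroExt.inl x + TrivSqZeroExt.inr 1 := by rw [hψ, aeval_X]
  have hP0 : p0 (fun i => ψ (bz i)) = ![x, 0, 1] := by
    funext i; fin_cases i <;> simp [p0, hψX]
  have hey : p0 (ey : Fin 3 → DualNumber ℂ) = ey := by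
    funext i; fin_cases i <;> simp [p0]
  obtain ⟨hmon, hdeg⟩ := lp_ey_monic hC.hF hC.h1 (fun i => ψ (bz i))
  rw [map_ff] at hz2
  have hmf := map_fst_lp F (fun i => ψ (bz i)) ey
  rw [hP0, hey] at hmf
  set f := lp F (fun i => ψ (bz i)) ey with hf
  have hs1 : (derivative (lp F ![x,0,1] ey)).eval η ≠ 0 := by
    rw [lp_eval_derivative, pt_z]
    exact hC.h4 _ hT
  have hs0 : (lp F ![x,0,1] ey).eval η = 0 := by
    rw [lp_eval, pt_z]; exact hη
  obtain ⟨y, hy, hfy⟩ := lift_root f η (by rw [hmf]; exact hs0) (by rw [hmf]; exact hs1)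
  obtain ⟨kk, hkk⟩ := dvd_iff_isRoot.mpr hfy
  have hkmon : kk.Monic := (monic_X_sub_C y).of_mul_monic_left (by rw [← hkk]; exact hmon)
  have hkd : 1 + kk.natDegree = k + 3 := by
    rw [← hdeg, hkk, (monic_X_sub_C y).natDegree_mul hkmon, natDegree_X_sub_C]
  have hgd : (g.map (ψ : ℂ[X] →+* DualNumber ℂ)).natDegree ≤ g.natDegree := natDegree_map_le
  have hgev : ev ψ y g = DD k F ez ((fun i => ψ (bz i)) + y • ey : Fin 3 → DualNumber ℂ) := ev_DD _ _ _ _ _ _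
  have hres := resultant_mul_left (X - C y) kk (g.map (ψ : ℂ[X] →+* DualNumber ℂ)) g.natDegree hgd
  rw [natDegree_X_sub_C, ← hkk, hkd, hz2, resultant_X_sub_C_left (hg := hgd), ← ev_apply, hgev] at hres
  have hpt : ((fun i => ψ (bz i)) + y • ey : Fin 3 → DualNumber ℂ) = ![TrivSqZeroExt.inl x + TrivSqZeroExt.inr 1, y, 1] := by
    funext i; fin_cases i <;> simp [hψX]
  have hFy : MvPolynomial.aeval ((fun i => ψ (bz i)) + y • ey : Fin 3 → DualNumber ℂ) F = 0 := by
    rw [← lp_eval]; exact hfy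
  have hne : DD k F ez ((fun i => ψ (bz i)) + y • ey : Fin 3 → DualNumber ℂ) ≠ 0 := by
    rw [hpt] at hFy ⊢
    refine transversal hC.hF hC.hG hC.hk ez _ ?_ ?_ ?_ hFy
    · simp [dt, p0]
    · simp [dt, p1]
    · intro h
      have := congrFun h 0
      simp [p1] at this
  have hk0 : lp F ![x,0,1] ey = (X - C η) * kk.map fstR := by
    rw [← hmf, hkk, Polynomial.map_mul, Polynomial.map_sub, map_X, map_C]
    congr 3
  have hunit : IsUnit (resultant kk (g.map (ψ : ℂ[X] →+* DualNumber ℂ)) kk.natDegree g.natDegree) := by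
    rw [TrivSqZeroExt.isUnit_iff_isUnit_fst, isUnit_iff_ne_zero]
    have e : (resultant kk (g.map (ψ : ℂ[X] →+* DualNumber ℂ)) kk.natDegree g.natDegree).fst =
        fstR (resultant kk (g.map (ψ : ℂ[X] →+* DualNumber ℂ)) kk.natDegree g.natDegree) := rfl
    rw [e, ← resultant_map_map, Polynomial.map_map]
    have hkm0 := hkmon.map fstR
    have hgd2 : (g.map (fstR.comp (ψ : ℂ[X] →+* DualNumber ℂ))).natDegree ≤ g.natDegree := natDegree_map_le
    have := resultant_eq_prod_eval (kk.map fstR) (g.map (fstR.comp (ψ : ℂ[X] →+* DualNumber ℂ))) g.natDegree hgd2 (IsAlgClosed.splits _)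
    rw [hkmon.natDegree_map, hkm0.leadingCoeff, one_pow, one_mul] at this
    rw [this]
    intro hprod
    obtain ⟨η', hη', hD⟩ := Multiset.mem_map.mp (Multiset.prod_eq_zero_iff.mp hprod)
    rw [mem_roots hkm0.ne_zero] at hη'
    have hcomp : fstR.comp (ψ : ℂ[X] →+* DualNumber ℂ) = ((Polynomial.aeval x : ℂ[X] →ₐ[ℂ] ℂ) : ℂ[X] →+* ℂ) := by
      apply Polynomial.ringHom_ext
      · intro a
        rw [hψ]
        simp [fstR, TrivSqZeroExt.algebraMap_eq_inl]
      · simp [hψX, fstR]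
    rw [hcomp, ← ev_apply, hg, ev_DD] at hD
    have hb : (fun i => (Polynomial.aeval x : ℂ[X] →ₐ[ℂ] ℂ) (bz i)) = ![x,0,1] := by
      funext i; fin_cases i <;> simp
    rw [hb, pt_z] at hD
    have hF' : MvPolynomial.aeval ![x,η',1] F = 0 := by
      rw [← pt_z, ← lp_eval, hk0, eval_mul, hη'.eq_zero, mul_zero]
    have hT' := (T_iff hC.hF hC.hG hC.hk _ _ (by simp [dt]) hF').mp hD
    have := T_unique hC x η η' hT hT'
    rw [this] at hη'
    apply hs1
    rw [hk0, derivative_mul]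
    simp [hη'.eq_zero]
  have := hres.symm
  rw [hunit.mul_left_eq_zero] at this
  exact hne this

theorem nu_roots_card {k : ℕ} {F : Form} (hC : Coord k F) : (nu k F).roots.toFinset.card = (k+3)*(k*((k+1)*(k+6))) := by
  have hn := nu_ne_zero hC.hF hC.h1 hC.hG hC.hk
  rw [← nu_natDegree hC, Multiset.toFinset_card_of_nodup, (IsAlgClosed.splits (nu k F)).natDegree_eq_card_roots]
  apply nodup_roots
  rw [separable_def, ]
  apply isCoprime_of_irreducible_dvd
  · rintro ⟨h, _⟩; exact hn h
  intro p hp h1 h2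
  obtain ⟨r, hr⟩ := IsAlgClosed.exists_root p (by rw [IsAlgClosed.degree_eq_one_of_irreducible ℂ hp]; norm_num)
  obtain ⟨c, hc⟩ := h1
  obtain ⟨c', hc'⟩ := h2
  exact nu_simple hC r (by rw [hc, eval_mul, hr.eq_zero, zero_mul]) (by rw [hc', eval_mul, hr.eq_zero, zero_mul])

end Bit

namespace Bit
open Polynomial

theorem IsT.zero {F : Form} {p : Fin 3 → ℂ} (h : IsT F p) : MvPolynomial.aeval p F = 0 := by
  obtain ⟨w, hw, h1, h2⟩ := h
  exact ((contact_iff F p w).mp h1).1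

theorem IsT.ne {F : Form} {p : Fin 3 → ℂ} (h : IsT F p) : p ≠ 0 := by
  obtain ⟨w, hw, h1, h2⟩ := h
  simpa using hw.ne_zero 0

theorem IsT.smul {k : ℕ} {F : Form} (hF : F.IsHomogeneous (k+3)) {p : Fin 3 → ℂ} (h : IsT F p) (c : ℂ) (hc : c ≠ 0) : IsT F (c • p) := by
  obtain ⟨w, hw, h1, h2⟩ := h
  rw [contact_iff] at h1 h2
  refine ⟨w, ?_, ?_, ?_⟩
  · rw [LinearIndependent.pair_iff] at *
    intro s t e
    rw [smul_smul] at e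
    obtain ⟨e1, e2⟩ := hw _ _ e
    exact ⟨(mul_eq_zero.mp e1).resolve_right hc, e2⟩
  · rw [contact_iff, aeval_smul hF, gr_smul_left hF, h1.1, h1.2]; simp
  · rw [contact_iff, gr_smul, h2.1, h2.2]; simp

theorem finrank_ker_grL {k : ℕ} {F : Form} (hs : Smooth F) {v : Fin 3 → ℂ} (hv : v ≠ 0)
    (h0 : MvPolynomial.aeval v F = 0) : Module.finrank ℂ (LinearMap.ker (grL F v)) = 2 := by
  obtain ⟨c, hc⟩ := hs.exists v hv h0
  have hr : LinearMap.range (grL F v) = ⊤ := by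
    apply LinearMap.range_eq_top.mpr
    intro y
    refine ⟨(y / gr F v c) • c, ?_⟩
    rw [map_smul]
    show (y / gr F v c) • gr F v c = y
    rw [smul_eq_mul, div_mul_cancel₀ _ hc]
  have := LinearMap.finrank_range_add_finrank_ker (grL F v)
  rw [hr] at this
  simp at this
  omega

theorem ker_eq {F : Form} {d : ℕ} (hF : F.IsHomogeneous d) (hs : Smooth F) {v w : Fin 3 → ℂ} (W : Submodule ℂ (Fin 3 → ℂ)) (hW : Module.finrank ℂ W = 2)
    (hv : v ∈ W) (hw : w ∈ W) (hli : LinearIndependent ℂ ![v, w]) (h : ContactLE F v w 2) : W = LinearMap.ker (grL F v) := by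
  rw [contact_iff] at h
  have hv0 : v ≠ 0 := by simpa using hli.ne_zero 0
  have hk := finrank_ker_grL (k := 0) hs hv0 h.1
  have hsp : Module.finrank ℂ (Submodule.span ℂ (Set.range ![v, w])) = 2 := by
    rw [finrank_span_eq_card hli]; simp
  have e1 : Submodule.span ℂ (Set.range ![v, w]) = W := by
    apply Submodule.eq_of_le_of_finrank_eq
    · rw [Submodule.span_le]
      rintro _ ⟨i, rfl⟩
      fin_cases i
      · exact hv
      · exact hw
    · rw [hsp, hW]
  rw [← e1]
  apply Submodule.eq_of_le_of_finrank_eq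
  · rw [Submodule.span_le]
    rintro _ ⟨i, rfl⟩
    fin_cases i
    · show gr F v v = 0
      rw [gr_self hF, h.1, mul_zero]
    · exact h.2
  · rw [hsp, hk]

theorem mem_span_pair {v w : Fin 3 → ℂ} (W : Submodule ℂ (Fin 3 → ℂ)) (hW : Module.finrank ℂ W = 2)
    (hv : v ∈ W) (hw : w ∈ W) (hli : LinearIndependent ℂ ![v, w]) (t : Fin 3 → ℂ) (ht : t ∈ W) :
    ∃ α β : ℂ, t = α • v + β • w := by
  have hsp : Module.finrank ℂ (Submodule.span ℂ {v, w}) = 2 := by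
    have := finrank_span_eq_card hli
    rw [Matrix.range_cons, Matrix.range_cons, Matrix.range_empty, Set.union_empty] at this
    exact this.trans (by simp)
  have e1 : Submodule.span ℂ {v, w} = W := by
    apply Submodule.eq_of_le_of_finrank_eq
    · rw [Submodule.span_le]
      rintro x (rfl | rfl)
      · exact hv
      · exact hw
    · rw [hsp, hW]
  rw [← e1, Submodule.mem_span_pair] at ht
  obtain ⟨a, b, h⟩ := ht
  exact ⟨a, b, h.symm⟩

/-- at most two tangency points on a line -/
theorem third {k : ℕ} {F : Form} (hF : F.IsHomogeneous (k+3)) (hG : Good (k+3) F)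
    {v w : Fin 3 → ℂ} (hli : LinearIndependent ℂ ![v, w]) (h1 : ContactLE F v w 2) (h2 : ContactLE F w v 2)
    (α β : ℂ) (ht0 : MvPolynomial.aeval (α • v + β • w) F = 0) (ht1 : gr F (α • v + β • w) v = 0) :
    α = 0 ∨ β = 0 := by
  by_contra hcon
  push Not at hcon
  obtain ⟨hα, hβ⟩ := hcon
  rw [contact_iff] at h1 h2
  have e : α • v + β • w = β • (w + (α/β) • v) := by
    rw [smul_add, smul_smul, mul_div_cancel₀ _ hβ, add_comm]
  rw [e, aeval_smul hF, mul_eq_zero, or_iff_right (pow_ne_zero _ hβ)] at ht0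
  rw [e, gr_smul_left hF, mul_eq_zero, or_iff_right (pow_ne_zero _ hβ)] at ht1
  have := double_unique hF hG v w hli h1.1 h1.2 0 (α/β) (by rw [lp_eval]; simpa using h2.1)
    (by rw [lp_eval_derivative]; simpa using h2.2) (by rw [lp_eval]; exact ht0) (by rw [lp_eval_derivative]; exact ht1)
  exact (div_ne_zero hα hβ) this

theorem smul_norm {p : Fin 3 → ℂ} (h : p 2 ≠ 0) : (p 2)⁻¹ • p = ![p 0 / p 2, p 1 / p 2, 1] := by
  funext i; fin_cases i <;> simp [h, div_eq_inv_mul]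

theorem ker_grL_smul {k : ℕ} {F : Form} (hF : F.IsHomogeneous (k+3)) (c : ℂ) (hc : c ≠ 0) (v : Fin 3 → ℂ) :
    LinearMap.ker (grL F (c • v)) = LinearMap.ker (grL F v) := by
  ext a
  show gr F (c • v) a = 0 ↔ gr F v a = 0
  rw [gr_smul_left hF, mul_eq_zero, or_iff_right (pow_ne_zero _ hc)]

theorem count_coord {k : ℕ} {F : Form} (hC : Coord k F) :
    (bitangentLines F).Finite ∧ 2 * (bitangentLines F).ncard = (k+3)*(k*((k+1)*(k+6))) := by
  classical
  have hn := nu_ne_zero hC.hF hC.h1 hC.hG hC.hk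
  set S := (nu k F).roots.toFinset with hS
  have hmem : ∀ x, x ∈ S ↔ ∃ η, IsT F ![x, η, 1] := by
    intro x
    rw [hS, Multiset.mem_toFinset, mem_roots hn, IsRoot.def, nu_root_iff hC]
    exact exists_congr fun η => ⟨fun h => h.2, fun h => ⟨h.zero, h⟩⟩
  choose! η hη using fun x => (hmem x).mp
  let ℓ : ℂ → Submodule ℂ (Fin 3 → ℂ) := fun x => LinearMap.ker (grL F ![x, η x, 1])
  have hℓ : ∀ x ∈ S, ℓ x ∈ bitangentLines F := by
    intro x hx
    have hT := hη x hx
    obtain ⟨w, hli, h1, h2⟩ := id hT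
    refine ⟨finrank_ker_grL (k := 0) hC.hG.toSmooth hT.ne hT.zero, ![x, η x, 1], w, ?_, ?_, hli, h1, h2⟩
    · show gr F _ _ = 0
      rw [gr_self hC.hF, hT.zero, mul_zero]
    · exact ((contact_iff _ _ _).mp h1).2
  -- tangency point to x-coordinate
  have hx : ∀ p, IsT F p → p 0 / p 2 ∈ S ∧ (p 2)⁻¹ • p = ![p 0 / p 2, η (p 0 / p 2), 1] := by
    intro p hp
    have h3 := hC.h3 p hp
    have hT := hp.smul hC.hF (p 2)⁻¹ (inv_ne_zero h3)
    rw [smul_norm h3] at hT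
    have hS' := (hmem _).mpr ⟨_, hT⟩
    refine ⟨hS', ?_⟩
    rw [smul_norm h3, T_unique hC _ _ _ hT (hη _ hS')]
  have hfib : ∀ W ∈ bitangentLines F, ∃ a b, a ≠ b ∧ {x ∈ S | ℓ x = W} = {a, b} := by
    rintro W ⟨hW, v, w, hv, hw, hli, h1, h2⟩
    have hTv : IsT F v := ⟨w, hli, h1, h2⟩
    have hTw : IsT F w := ⟨v, li_swap hli, h2, h1⟩
    have hv3 := hC.h3 v hTv
    have hw3 := hC.h3 w hTw
    obtain ⟨hvS, hv1⟩ := hx v hTv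
    obtain ⟨hwS, hw1⟩ := hx w hTw
    have hWv := ker_eq hC.hF hC.hG.toSmooth W hW hv hw hli h1
    have hWw := ker_eq hC.hF hC.hG.toSmooth W hW hw hv (li_swap hli) h2
    refine ⟨v 0 / v 2, w 0 / w 2, ?_, ?_⟩
    · intro he
      rw [div_eq_div_iff hv3 hw3] at he
      obtain ⟨c, hc⟩ := hC.h5 v w hTv hTw he
      have := li_smul_eq hli c (-1) (by rw [hc]; module)
      simp at this
    · ext x
      simp only [Finset.mem_filter, Finset.mem_insert, Finset.mem_singleton]
      constructor
      · rintro ⟨hxS, hxW⟩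
        have hT := hη x hxS
        have htW : ![x, η x, 1] ∈ W := by
          rw [← hxW]; show gr F _ _ = 0
          rw [gr_self hC.hF, hT.zero, mul_zero]
        obtain ⟨α, β, ht⟩ := mem_span_pair W hW hv hw hli _ htW
        have hvx : gr F ![x, η x, 1] v = 0 := by
          have : v ∈ ℓ x := by rw [hxW]; exact hv
          exact this
        have h0 := hT.zero
        have e0 := congrFun ht 0
        have e2 := congrFun ht 2
        simp at e0 e2
        rw [ht] at hvx h0
        rcases third hC.hF hC.hG hli h1 h2 α β h0 hvx with h | h
        · right
          rw [h] at e0 e2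
          rw [eq_div_iff hw3]
          linear_combination w 2 * e0 - w 0 * e2
        · left
          rw [h] at e0 e2
          rw [eq_div_iff hv3]
          linear_combination v 2 * e0 - v 0 * e2
      · rintro (rfl | rfl)
        · refine ⟨hvS, ?_⟩
          show LinearMap.ker (grL F _) = W
          rw [← hv1, ker_grL_smul hC.hF _ (inv_ne_zero hv3), hWv]
        · refine ⟨hwS, ?_⟩
          show LinearMap.ker (grL F _) = W
          rw [← hw1, ker_grL_smul hC.hF _ (inv_ne_zero hw3), hWw]
  have himg : bitangentLines F = ↑(S.image ℓ) := by
    ext W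
    rw [Finset.mem_coe, Finset.mem_image]
    constructor
    · intro hW
      obtain ⟨a, b, hab, he⟩ := hfib W hW
      have : a ∈ ({x ∈ S | ℓ x = W} : Finset ℂ) := by rw [he]; simp
      rw [Finset.mem_filter] at this
      exact ⟨a, this⟩
    · rintro ⟨x, hx, rfl⟩; exact hℓ x hx
  have hcard : S.card = 2 * (S.image ℓ).card := by
    rw [Finset.card_eq_sum_card_image ℓ S, Finset.sum_const_nat (m := 2), mul_comm]
    intro W hW
    have : W ∈ bitangentLines F := by rw [himg]; exact hW
    obtain ⟨a, b, hab, he⟩ := hfib W this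
    rw [he, Finset.card_pair hab]
  constructor
  · rw [himg]; exact Finset.finite_toSet _
  · rw [himg, Set.ncard_coe_finset, ← hcard, hS, nu_roots_card hC]

end Bit

namespace Bit
open Polynomial

abbrev V3 := Fin 3 → ℂ

/-- linear substitution -/
def tr (e : V3 ≃ₗ[ℂ] V3) (F : Form) : Form :=
  MvPolynomial.aeval (fun i => ∑ j, MvPolynomial.C (e (Pi.single j 1) i) * MvPolynomial.X j) F

theorem e_apply (e : V3 ≃ₗ[ℂ] V3) (v : V3) (i : Fin 3) : e v i = ∑ j, e (Pi.single j 1) i * v j := by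
  have h : v = ∑ j, v j • (Pi.single j 1 : V3) := by
    funext i; simp [Finset.sum_apply, Pi.single_apply]
  conv_lhs => rw [h]
  rw [map_sum, Finset.sum_apply]
  exact Finset.sum_congr rfl fun j _ => by rw [map_smul]; simp [mul_comm]

theorem linePoly_tr (e : V3 ≃ₗ[ℂ] V3) (F : Form) (v w : V3) : linePoly (tr e F) v w = linePoly F (e v) (e w) := by
  unfold linePoly tr
  rw [MvPolynomial.comp_aeval_apply]
  congr 2
  funext i
  rw [e_apply e v, e_apply e w, map_sum, map_sum, map_sum, Finset.mul_sum, ← Finset.sum_add_distrib]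
  refine Finset.sum_congr rfl fun j _ => ?_
  rw [map_mul, MvPolynomial.aeval_X, MvPolynomial.aeval_C, C_mul, C_mul, algebraMap_eq]
  ring

theorem tr_hom {d : ℕ} {F : Form} (hF : F.IsHomogeneous d) (e : V3 ≃ₗ[ℂ] V3) : (tr e F).IsHomogeneous d := by
  have := MvPolynomial.IsHomogeneous.aeval hF (fun i => ∑ j, MvPolynomial.C (e (Pi.single j 1) i) * (MvPolynomial.X j : Form)) (n := 1) (fun i => by
    apply MvPolynomial.IsHomogeneous.sum
    intro j _
    exact MvPolynomial.isHomogeneous_C_mul_X _ _)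
  simpa [tr] using this

theorem aeval_tr (e : V3 ≃ₗ[ℂ] V3) (F : Form) (v : V3) : MvPolynomial.aeval v (tr e F) = MvPolynomial.aeval (e v) F := by
  rw [← lp_coeff_zero (tr e F) v v, lp_eq_linePoly, linePoly_tr, ← lp_eq_linePoly, lp_coeff_zero]
theorem gr_tr (e : V3 ≃ₗ[ℂ] V3) (F : Form) (v w : V3) : gr (tr e F) v w = gr F (e v) (e w) := by
  rw [← lp_coeff_one, lp_eq_linePoly, linePoly_tr, ← lp_eq_linePoly, lp_coeff_one]

theorem contact_tr (e : V3 ≃ₗ[ℂ] V3) (F : Form) (v w : V3) (m : ℕ) : ContactLE (tr e F) v w m ↔ ContactLE F (e v) (e w) m := by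
  unfold ContactLE; rw [linePoly_tr]

theorem li_tr (e : V3 ≃ₗ[ℂ] V3) (v w : V3) : LinearIndependent ℂ ![e v, e w] ↔ LinearIndependent ℂ ![v, w] := by
  rw [LinearIndependent.pair_iff, LinearIndependent.pair_iff]
  have : ∀ s t : ℂ, s • e v + t • e w = 0 ↔ s • v + t • w = 0 := by
    intro s t
    rw [← map_smul, ← map_smul, ← map_add, LinearEquiv.map_eq_zero_iff]
  simp only [this]

theorem IsT_tr (e : V3 ≃ₗ[ℂ] V3) (F : Form) (p : V3) : IsT (tr e F) p ↔ IsT F (e p) := by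
  constructor
  · rintro ⟨w, h, h1, h2⟩
    exact ⟨e w, (li_tr e p w).mpr h, (contact_tr e F p w 2).mp h1, (contact_tr e F w p 2).mp h2⟩
  · rintro ⟨w, h, h1, h2⟩
    obtain ⟨w, rfl⟩ := e.surjective w
    exact ⟨w, (li_tr e p w).mp h, (contact_tr e F p w 2).mpr h1, (contact_tr e F w p 2).mpr h2⟩

theorem Smooth_tr (e : V3 ≃ₗ[ℂ] V3) {F : Form} (h : Smooth F) : Smooth (tr e F) := by
  constructor
  intro v hv
  obtain ⟨w, hw⟩ := h.sm (e v) (by simpa using hv)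
  obtain ⟨w, rfl⟩ := e.surjective w
  exact ⟨w, fun h => hw ((contact_tr e F v w 2).mp h)⟩

theorem Good_tr (e : V3 ≃ₗ[ℂ] V3) {d : ℕ} {F : Form} (h : Good d F) : Good d (tr e F) where
  toSmooth := Smooth_tr e h.toSmooth
  ga v w hl h1 := by
    rw [linePoly_tr] at h1
    exact h.ga _ _ ((li_tr e v w).mpr hl) h1
  gb v w hl a h1 h2 := by
    rw [linePoly_tr] at h1 h2
    exact h.gb _ _ ((li_tr e v w).mpr hl) a h1 h2
  gc v w hl a b h1 h2 := by
    rw [linePoly_tr] at h1 h2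
    exact h.gc _ _ ((li_tr e v w).mpr hl) a b h1 h2

theorem bit_tr (e : V3 ≃ₗ[ℂ] V3) (F : Form) :
    bitangentLines F = (Submodule.map (e : V3 →ₗ[ℂ] V3)) '' bitangentLines (tr e F) := by
  ext W
  constructor
  · rintro ⟨hW, v, w, hv, hw, hli, h1, h2⟩
    obtain ⟨v, rfl⟩ := e.surjective v
    obtain ⟨w, rfl⟩ := e.surjective w
    refine ⟨W.map (e.symm : V3 →ₗ[ℂ] V3), ⟨?_, v, w, ?_, ?_, (li_tr e v w).mp hli, (contact_tr e F v w 2).mpr h1, (contact_tr e F w v 2).mpr h2⟩, ?_⟩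
    · rw [← hW]; exact LinearEquiv.finrank_map_eq e.symm W
    · exact ⟨e v, hv, by simp⟩
    · exact ⟨e w, hw, by simp⟩
    · rw [← Submodule.map_comp]; simp
  · rintro ⟨W, ⟨hW, v, w, hv, hw, hli, h1, h2⟩, rfl⟩
    refine ⟨?_, e v, e w, ⟨v, hv, rfl⟩, ⟨w, hw, rfl⟩, (li_tr e v w).mpr hli, (contact_tr e F v w 2).mp h1, (contact_tr e F w v 2).mp h2⟩
    rw [← hW]; exact LinearEquiv.finrank_map_eq e W

theorem count_tr (e : V3 ≃ₗ[ℂ] V3) (F : Form) (N : ℕ) (h : (bitangentLines (tr e F)).Finite ∧ 2 * (bitangentLines (tr e F)).ncard = N) :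
    (bitangentLines F).Finite ∧ 2 * (bitangentLines F).ncard = N := by
  rw [bit_tr e F]
  refine ⟨h.1.image _, ?_⟩
  rw [Set.ncard_image_of_injective _ (Submodule.map_injective_of_injective e.injective), h.2]

/-- avoiding finitely many hypersurfaces -/
theorem avoid (F : Form) (hF : F ≠ 0) (L : Finset V3) (hL : ∀ n ∈ L, n ≠ 0) :
    ∃ O : V3, MvPolynomial.aeval O F ≠ 0 ∧ ∀ n ∈ L, dt n O ≠ 0 := by
  let lin : V3 → Form := fun n => ∑ i, MvPolynomial.C (n i) * MvPolynomial.X i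
  have hlin : ∀ n O, MvPolynomial.eval O (lin n) = dt n O := by
    intro n O
    simp [lin, dt, Fin.sum_univ_three]
  have hlin0 : ∀ n, n ≠ 0 → lin n ≠ 0 := by
    intro n hn h
    apply hn
    funext i
    have := hlin n (Pi.single i 1)
    rw [h, map_zero] at this
    fin_cases i <;> simpa [dt] using this.symm
  have hP : F * ∏ n ∈ L, lin n ≠ 0 := mul_ne_zero hF (Finset.prod_ne_zero_iff.mpr fun n hn => hlin0 n (hL n hn))
  obtain ⟨O, hO⟩ : ∃ O, MvPolynomial.eval O (F * ∏ n ∈ L, lin n) ≠ 0 := by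
    by_contra hcon
    push Not at hcon
    exact hP (MvPolynomial.funext (fun x => by rw [hcon x, map_zero]))
  rw [map_mul, map_prod, mul_ne_zero_iff, Finset.prod_ne_zero_iff] at hO
  refine ⟨O, by rw [MvPolynomial.aeval_eq_eval]; exact hO.1, fun n hn => ?_⟩
  rw [← hlin]; exact hO.2 n hn

/-- coordinates with prescribed basis -/
theorem exists_basis (P O Q : V3) (h : dt (cr O Q) P ≠ 0) :
    ∃ e : V3 ≃ₗ[ℂ] V3, ∀ x y z : ℂ, e ![x,y,z] = x • P + y • O + z • Q := by
  let M : Matrix (Fin 3) (Fin 3) ℂ := !![P 0, O 0, Q 0; P 1, O 1, Q 1; P 2, O 2, Q 2]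
  have hM : M.det ≠ 0 := by
    have : M.det = dt (cr O Q) P := by
      rw [Matrix.det_fin_three]; simp [M, dt, cr]; ring
    rw [this]; exact h
  refine ⟨Matrix.toLinearEquiv' M (M.invertibleOfIsUnitDet hM.isUnit), fun x y z => ?_⟩
  show M.mulVec ![x,y,z] = _
  funext i
  fin_cases i <;> simp [M, Matrix.mulVec, dotProduct, Fin.sum_univ_three] <;> ring

theorem avoid1 {k : ℕ} {F : Form} (hF : F.IsHomogeneous (k+3)) (hF0 : F ≠ 0) (L : Finset V3) (hL : ∀ n ∈ L, n ≠ 0) :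
    ∃ O : V3, MvPolynomial.aeval O F = 1 ∧ ∀ n ∈ L, dt n O ≠ 0 := by
  obtain ⟨O, hO, hn⟩ := avoid F hF0 L hL
  obtain ⟨c, hc⟩ := IsAlgClosed.exists_pow_nat_eq (MvPolynomial.aeval O F)⁻¹ (n := k+3) (by omega)
  have hc0 : c ≠ 0 := by
    rintro rfl
    rw [zero_pow (by omega)] at hc
    exact inv_ne_zero hO hc.symm
  refine ⟨c • O, by rw [aeval_smul hF, hc, inv_mul_cancel₀ hO], fun n hn' => ?_⟩
  rw [dt_smul]; exact mul_ne_zero hc0 (hn n hn')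

theorem exists_other (O : V3) (hO : O ≠ 0) : ∃ m : V3, cr O m ≠ 0 := by
  by_contra hcon
  push Not at hcon
  apply hO
  have h0 := hcon ![1,0,0]
  have h1 := hcon ![0,1,0]
  have a1 := congrFun h0 1
  have a2 := congrFun h0 2
  have a3 := congrFun h1 2
  simp [cr] at a1 a2 a3
  funext i; fin_cases i <;> simp [a1, a2, a3]

theorem T_finite1 {k : ℕ} {F : Form} (hF : F.IsHomogeneous (k+3)) (h1 : MvPolynomial.aeval (ey : Fin 3 → ℂ) F = 1)
    (hG : Good (k+3) F) (hk : k ≠ 0) : ∃ L : Finset V3, ∀ t, IsT F t → ∃ t' ∈ L, ∃ c : ℂ, c ≠ 0 ∧ t = c • t' := by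
  classical
  refine ⟨((nu k F).roots.toFinset).biUnion (fun x => (lp F ![x,0,1] ey).roots.toFinset.image (fun η => ![x,η,1])) ∪
    (lp F ![1,0,0] ey).roots.toFinset.image (fun η => ![1,η,0]), fun t ht => ?_⟩
  by_cases h2 : t 2 = 0
  · have h0 : t 0 ≠ 0 := by
      intro h0
      have e : t = t 1 • ey := by funext i; fin_cases i <;> simp [h0, h2]
      have := ht.zero
      rw [e, aeval_smul hF, h1, mul_one] at this
      have h3 := pow_eq_zero_iff (by omega) |>.mp this
      apply ht.ne
      rw [e, h3, zero_smul]
    refine ⟨![1, t 1 / t 0, 0], ?_, t 0, h0, ?_⟩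
    · rw [Finset.mem_union, Finset.mem_image]
      right
      refine ⟨t 1 / t 0, ?_, rfl⟩
      rw [Multiset.mem_toFinset, lp_roots_mem hF h1, pt_x]
      have hT := (ht.smul hF (t 0)⁻¹ (inv_ne_zero h0)).zero
      convert hT using 2
      congr 1
      funext i; fin_cases i <;> simp [h0, h2, div_eq_inv_mul]
    · funext i; fin_cases i <;> simp [h0, h2, mul_div_cancel₀]
  · have hT := (ht.smul hF (t 2)⁻¹ (inv_ne_zero h2))
    rw [smul_norm h2] at hT
    refine ⟨![t 0 / t 2, t 1 / t 2, 1], ?_, t 2, h2, ?_⟩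
    · rw [Finset.mem_union, Finset.mem_biUnion]
      left
      have hη : t 1 / t 2 ∈ (lp F ![t 0 / t 2, 0, 1] ey).roots := by
        rw [lp_roots_mem hF h1, pt_z]; exact hT.zero
      refine ⟨t 0 / t 2, ?_, ?_⟩
      · rw [Multiset.mem_toFinset, mem_roots (nu_ne_zero hF h1 hG hk), IsRoot.def, nu_eval hF h1, Multiset.prod_eq_zero_iff, Multiset.mem_map]
        exact ⟨_, hη, (T_iff hF hG hk _ _ (by simp [dt]) hT.zero).mpr hT⟩
      · rw [Finset.mem_image]
        exact ⟨t 1 / t 2, by rw [Multiset.mem_toFinset]; exact hη, rfl⟩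
    · rw [← smul_norm h2, smul_smul, mul_inv_cancel₀ h2, one_smul]

theorem T_finite {k : ℕ} {F : Form} (hF : F.IsHomogeneous (k+3)) (hF0 : F ≠ 0)
    (hG : Good (k+3) F) (hk : k ≠ 0) : ∃ L : Finset V3, (∀ t ∈ L, IsT F t) ∧ ∀ t, IsT F t → ∃ t' ∈ L, ∃ c : ℂ, c ≠ 0 ∧ t = c • t' := by
  classical
  obtain ⟨O, hO, -⟩ := avoid1 hF hF0 ∅ (by simp)
  have hO0 : O ≠ 0 := by
    rintro rfl
    have := aeval_smul hF (0:ℂ) (0:V3)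
    rw [smul_zero, zero_pow (by omega), zero_mul, hO] at this
    exact one_ne_zero this
  obtain ⟨m, hm⟩ := exists_other O hO0
  obtain ⟨P, -, hP⟩ := avoid F hF0 {cr O m} (by simpa using hm)
  obtain ⟨e, he⟩ := exists_basis P O m (hP _ (by simp))
  have hey : e ey = O := by rw [he]; simp
  obtain ⟨L, hL⟩ := T_finite1 (tr_hom hF e) (by rw [aeval_tr, hey, hO]) (Good_tr e hG) hk
  refine ⟨(L.image e).filter (fun t => IsT F t), fun t ht => (Finset.mem_filter.mp ht).2, fun t ht => ?_⟩
  obtain ⟨s, rfl⟩ := e.surjective t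
  obtain ⟨t', ht', c, hc, hs⟩ := hL s ((IsT_tr e F s).mpr ht)
  have hs' : e s = c • e t' := by rw [hs, map_smul]
  refine ⟨e t', ?_, c, hc, hs'⟩
  rw [Finset.mem_filter, Finset.mem_image]
  refine ⟨⟨t', ht', rfl⟩, ?_⟩
  have := ht.smul hF c⁻¹ (inv_ne_zero hc)
  rwa [hs', smul_smul, inv_mul_cancel₀ hc, one_smul] at this

theorem exists_coord {k : ℕ} {F : Form} (hF : F.IsHomogeneous (k+3)) (hF0 : F ≠ 0)
    (hG : Good (k+3) F) (hk : k ≠ 0) : ∃ e : V3 ≃ₗ[ℂ] V3, Coord k (tr e F) := by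
  classical
  obtain ⟨L, hLT, hL⟩ := T_finite hF hF0 hG hk
  obtain ⟨O, hO, hOn⟩ := avoid1 hF hF0 (L.image (nb F) ∪ ((L ×ˢ L).image (fun q => cr q.1 q.2)).filter (fun n => n ≠ 0)) (by
    intro n hn
    rw [Finset.mem_union] at hn
    rcases hn with hn | hn
    · obtain ⟨t, ht, rfl⟩ := Finset.mem_image.mp hn
      exact nb_ne hG.toSmooth t (hLT t ht).ne (hLT t ht).zero
    · exact (Finset.mem_filter.mp hn).2)
  have hO0 : O ≠ 0 := by
    rintro rfl
    have := aeval_smul hF (0:ℂ) (0:V3)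
    rw [smul_zero, zero_pow (by omega), zero_mul, hO] at this
    exact one_ne_zero this
  obtain ⟨m, hm⟩ := exists_other O hO0
  obtain ⟨P, hP, hPn⟩ := avoid F hF0 (insert (cr O m) (L.image (fun t => cr O t))) (by
    intro n hn
    rw [Finset.mem_insert] at hn
    rcases hn with rfl | hn
    · exact hm
    · obtain ⟨t, ht, rfl⟩ := Finset.mem_image.mp hn
      intro h0
      obtain ⟨c, hc⟩ := cr_eq_zero hO0 h0
      have hz := (hLT t ht).zero
      rw [hc, aeval_smul hF, hO, mul_one] at hz
      have h3 := pow_eq_zero_iff (by omega) |>.mp hz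
      apply (hLT t ht).ne
      rw [hc, h3, zero_smul])
  have hdet : dt (cr O m) P ≠ 0 := hPn _ (by simp)
  obtain ⟨e, he⟩ := exists_basis P O m hdet
  have hev : ∀ p : V3, e p = p 0 • P + p 1 • O + p 2 • m := by
    intro p
    rw [← he]; congr 1; funext i; fin_cases i <;> rfl
  have hey : e ey = O := by rw [he]; simp
  have hex : e ![1,0,0] = P := by rw [he]; simp
  refine ⟨e, tr_hom hF e, Good_tr e hG, hk, by rw [aeval_tr, hey, hO], by rw [aeval_tr, hex]; exact hP, ?_, ?_, ?_⟩
  · intro p hp h2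
    rw [IsT_tr] at hp
    obtain ⟨t, ht, c, hc, hs⟩ := hL _ hp
    have hn := hPn (cr O t) (by rw [Finset.mem_insert]; right; exact Finset.mem_image_of_mem _ ht)
    have e1 : dt (cr O (e p)) P = 0 := by
      rw [hev, h2]; simp [dt, cr]; ring
    rw [hs] at e1
    have e2 : dt (cr O (c • t)) P = c * dt (cr O t) P := by simp [dt, cr]; ring
    rw [e2] at e1
    exact mul_ne_zero hc hn e1
  · intro p hp
    rw [IsT_tr] at hp
    obtain ⟨t, ht, c, hc, hs⟩ := hL _ hp
    rw [gr_tr, hey, hs, gr_smul_left hF]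
    refine mul_ne_zero (pow_ne_zero _ hc) ?_
    rw [gr_eq_dt]
    exact hOn _ (by rw [Finset.mem_union]; left; exact Finset.mem_image_of_mem _ ht)
  · intro p p' hp hp' hpp
    rw [IsT_tr] at hp hp'
    obtain ⟨t, ht, c, hc, hs⟩ := hL _ hp
    obtain ⟨t', ht', c', hc', hs'⟩ := hL _ hp'
    have e1 : dt (cr (e p) (e p')) O = 0 := by
      have : dt (cr (e p) (e p')) O = (p 0 * p' 2 - p 2 * p' 0) * dt (cr O P) m := by
        rw [hev, hev]; simp [dt, cr]; ring
      rw [this]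
      linear_combination (dt (cr O P) m) * hpp
    have e2 : dt (cr (c • t) (c' • t')) O = c * c' * dt (cr t t') O := by simp [dt, cr]; ring
    rw [hs, hs', e2] at e1
    have e3 : dt (cr t t') O = 0 := (mul_eq_zero.mp e1).resolve_left (mul_ne_zero hc hc')
    have e4 : cr t t' = 0 := by
      by_contra hne
      refine hOn (cr t t') ?_ e3
      rw [Finset.mem_union, Finset.mem_filter]
      right
      exact ⟨Finset.mem_image.mpr ⟨(t, t'), by simp [ht, ht'], rfl⟩, hne⟩
    obtain ⟨a, ha⟩ := cr_eq_zero (hLT t ht).ne e4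
    refine ⟨c' * a * c⁻¹, e.injective ?_⟩
    rw [map_smul, hs, hs', ha, smul_smul, smul_smul, mul_assoc (c' * a), inv_mul_cancel₀ hc, mul_one]

theorem count_good {k : ℕ} {F : Form} (hF : F.IsHomogeneous (k+3)) (hF0 : F ≠ 0)
    (hG : Good (k+3) F) (hk : k ≠ 0) :
    (bitangentLines F).Finite ∧ 2 * (bitangentLines F).ncard = (k+3)*(k*((k+1)*(k+6))) := by
  obtain ⟨e, he⟩ := exists_coord hF hF0 hG hk
  exact count_tr e F _ (count_coord he)

end Bit

namespace Bit

abbrev Idx (d : ℕ) : Finset (Fin 3 →₀ ℕ) := Finset.finsuppAntidiag Finset.univ d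

theorem mem_Idx {d : ℕ} {m : Fin 3 →₀ ℕ} : m ∈ Idx d ↔ m 0 + m 1 + m 2 = d := by
  rw [Finset.mem_finsuppAntidiag, Fin.sum_univ_three]
  simp

def cf (d : ℕ) (F : Form) : ↥(Idx d) → ℂ := fun m => MvPolynomial.coeff m.1 F

def Gen (d : ℕ) (P : Form → Prop) : Prop :=
  ∃ Q : MvPolynomial ↥(Idx d) ℂ, Q ≠ 0 ∧ ∀ F : Form, F.IsHomogeneous d → MvPolynomial.eval (cf d F) Q ≠ 0 → P F

theorem Gen.and {d : ℕ} {P P' : Form → Prop} (h : Gen d P) (h' : Gen d P') : Gen d (fun F => P F ∧ P' F) := by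
  obtain ⟨Q, hQ, h⟩ := h
  obtain ⟨Q', hQ', h'⟩ := h'
  refine ⟨Q * Q', mul_ne_zero hQ hQ', fun F hF hne => ?_⟩
  rw [map_mul, mul_ne_zero_iff] at hne
  exact ⟨h F hF hne.1, h' F hF hne.2⟩

theorem Gen.mono {d : ℕ} {P P' : Form → Prop} (h : Gen d P) (h' : ∀ F : Form, F.IsHomogeneous d → P F → P' F) : Gen d P' := by
  obtain ⟨Q, hQ, h⟩ := h
  exact ⟨Q, hQ, fun F hF hne => h' F hF (h F hF hne)⟩

theorem Gen.all {d : ℕ} {ι : Type*} [Fintype ι] {P : ι → Form → Prop} (h : ∀ i, Gen d (P i)) : Gen d (fun F => ∀ i, P i F) := by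
  choose Q hQ h using h
  refine ⟨∏ i, Q i, Finset.prod_ne_zero_iff.mpr fun i _ => hQ i, fun F hF hne i => ?_⟩
  rw [map_prod, Finset.prod_ne_zero_iff] at hne
  exact h i F hF (hne i (Finset.mem_univ i))

theorem exists_rel {ι κ : Type} [Fintype ι] [Fintype κ] (h : Fintype.card κ < Fintype.card ι) (G : ι → MvPolynomial κ ℂ) :
    ∃ Q : MvPolynomial ι ℂ, Q ≠ 0 ∧ MvPolynomial.aeval G Q = 0 := by
  by_contra hcon
  push Not at hcon
  have hal : AlgebraicIndependent ℂ G := by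
    rw [algebraicIndependent_iff]
    intro p hp
    by_contra h0
    exact hcon p h0 hp
  have := hal.lift_cardinalMk_le_trdeg
  rw [MvPolynomial.trdeg_of_isDomain] at this
  simp at this
  omega

theorem dimcount {d : ℕ} {κ J : Type} [Fintype κ] [Fintype J] (E : J → MvPolynomial (Fin 3) (MvPolynomial κ ℂ))
    (hc : Fintype.card κ + Fintype.card J < (Idx d).card) :
    Gen d (fun F => ∀ (c : κ → ℂ) (a : J → ℂ), F ≠ ∑ j, MvPolynomial.C (a j) * MvPolynomial.map (MvPolynomial.eval c) (E j)) := by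
  let G : ↥(Idx d) → MvPolynomial (κ ⊕ J) ℂ := fun m =>
    ∑ j, MvPolynomial.X (Sum.inr j) * MvPolynomial.rename Sum.inl (MvPolynomial.coeff m.1 (E j))
  obtain ⟨Q, hQ, hrel⟩ := exists_rel (by rw [Fintype.card_sum, Fintype.card_coe]; exact hc) G
  refine ⟨Q, hQ, fun F hF hne c a hFe => hne ?_⟩
  have h1 := congrArg (MvPolynomial.aeval (Sum.elim c a) : MvPolynomial (κ ⊕ J) ℂ →ₐ[ℂ] ℂ) hrel
  rw [MvPolynomial.comp_aeval_apply, map_zero, MvPolynomial.aeval_eq_eval] at h1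
  rw [← h1]
  congr 2
  funext m
  rw [cf, hFe, MvPolynomial.coeff_sum]
  simp only [G, map_sum, map_mul, MvPolynomial.aeval_X, Sum.elim_inr, MvPolynomial.aeval_rename, Sum.elim_comp_inl, MvPolynomial.coeff_C_mul, MvPolynomial.coeff_map]
  rfl

theorem Gen.final {d : ℕ} {P : Form → Prop} (h : Gen d P) :
    ∃ Q : MvPolynomial (Fin 3 →₀ ℕ) ℂ, (∃ F : Form, F.IsHomogeneous d ∧ F ≠ 0 ∧ MvPolynomial.eval (coeffs1 F) Q ≠ 0) ∧
      ∀ F : Form, F.IsHomogeneous d → F ≠ 0 → MvPolynomial.eval (coeffs1 F) Q ≠ 0 → P F := by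
  obtain ⟨Q, hQ, h⟩ := h
  have hev : ∀ F : Form, MvPolynomial.eval (coeffs1 F) (MvPolynomial.rename Subtype.val Q) = MvPolynomial.eval (cf d F) Q := by
    intro F
    rw [MvPolynomial.eval_rename]; rfl
  refine ⟨MvPolynomial.rename Subtype.val Q, ?_, fun F hF _ hne => h F hF (by rw [← hev]; exact hne)⟩
  let m0 : ↥(Idx d) := ⟨Finsupp.single 0 d, by rw [mem_Idx]; simp⟩
  obtain ⟨c, hc⟩ : ∃ c, MvPolynomial.eval c (Q * MvPolynomial.X m0) ≠ 0 := by
    by_contra hcon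
    push Not at hcon
    exact (mul_ne_zero hQ (MvPolynomial.X_ne_zero m0)) (MvPolynomial.funext (fun x => by rw [hcon x, map_zero]))
  rw [map_mul, mul_ne_zero_iff, MvPolynomial.eval_X] at hc
  let F : Form := ∑ m : ↥(Idx d), MvPolynomial.monomial m.1 (c m)
  have hcf : cf d F = c := by
    funext m
    simp only [cf, F, MvPolynomial.coeff_sum, MvPolynomial.coeff_monomial]
    rw [Finset.sum_eq_single m]
    · simp
    · intro b _ hb
      rw [if_neg]; intro h; exact hb (Subtype.ext h)
    · simp
  refine ⟨F, ?_, ?_, ?_⟩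
  · apply MvPolynomial.IsHomogeneous.sum
    intro m _
    apply MvPolynomial.isHomogeneous_monomial
    have := mem_Idx.mp m.2
    rw [Finsupp.degree_eq_sum, Fin.sum_univ_three]; exact this
  · intro h0
    apply hc.2
    rw [← hcf, h0]; simp [cf]
  · rw [hev, hcf]; exact hc.1

theorem aeval_hom {d : ℕ} {F : Form} (hF : F.IsHomogeneous d) {A : Type*} [CommRing A] [Algebra ℂ A] (x : Fin 3 → A) :
    MvPolynomial.aeval x F = ∑ m ∈ Idx d, algebraMap ℂ A (MvPolynomial.coeff m F) * (x 0 ^ m 0 * x 1 ^ m 1 * x 2 ^ m 2) := by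
  rw [MvPolynomial.aeval_def, MvPolynomial.eval₂_eq']
  simp only [Fin.prod_univ_three]
  apply Finset.sum_subset
  · intro m hm
    rw [mem_Idx]
    have := hF (MvPolynomial.mem_support_iff.mp hm)
    rw [Finsupp.weight_apply, Finsupp.sum_fintype _ _ (by simp), Fin.sum_univ_three] at this
    simpa using this
  · intro m _ hm
    rw [MvPolynomial.notMem_support_iff.mp hm]; simp

/-- substitution by three vectors -/
def tr3 (v w z : V3) (F : Form) : Form :=
  MvPolynomial.aeval (fun i => MvPolynomial.C (v i) * MvPolynomial.X 0 + MvPolynomial.C (w i) * MvPolynomial.X 1 + MvPolynomial.C (z i) * MvPolynomial.X 2) F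

theorem tr3_hom {d : ℕ} {F : Form} (hF : F.IsHomogeneous d) (v w z : V3) : (tr3 v w z F).IsHomogeneous d := by
  have := MvPolynomial.IsHomogeneous.aeval hF (fun i => MvPolynomial.C (v i) * MvPolynomial.X 0 + MvPolynomial.C (w i) * MvPolynomial.X 1 + MvPolynomial.C (z i) * (MvPolynomial.X 2 : Form)) (n := 1) (fun i =>
    ((MvPolynomial.isHomogeneous_C_mul_X _ _).add (MvPolynomial.isHomogeneous_C_mul_X _ _)).add (MvPolynomial.isHomogeneous_C_mul_X _ _))
  simpa [tr3] using this

theorem tr3_aeval (v w z : V3) (F : Form) (x : V3) :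
    MvPolynomial.aeval x (tr3 v w z F) = MvPolynomial.aeval (x 0 • v + x 1 • w + x 2 • z) F := by
  unfold tr3
  rw [MvPolynomial.comp_aeval_apply]
  congr 2
  funext i
  simp [mul_comm]

end Bit

namespace Bit

def bv (σ : Equiv.Perm (Fin 3)) (p q r : ℂ) : V3 := fun i => (![p, q, r] : Fin 3 → ℂ) (σ.symm i)

theorem bv0 (σ : Equiv.Perm (Fin 3)) (p q r : ℂ) : bv σ p q r (σ 0) = p := by simp [bv]
theorem bv1 (σ : Equiv.Perm (Fin 3)) (p q r : ℂ) : bv σ p q r (σ 1) = q := by simp [bv]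
theorem bv2 (σ : Equiv.Perm (Fin 3)) (p q r : ℂ) : bv σ p q r (σ 2) = r := by simp [bv]

theorem ext_perm (σ : Equiv.Perm (Fin 3)) {x y : V3} (h0 : x (σ 0) = y (σ 0)) (h1 : x (σ 1) = y (σ 1))
    (h2 : x (σ 2) = y (σ 2)) : x = y := by
  funext i
  obtain ⟨j, rfl⟩ := σ.surjective i
  fin_cases j
  · exact h0
  · exact h1
  · exact h2

def f' (σ : Equiv.Perm (Fin 3)) (a b c : ℂ) (F : Form) : Form := tr3 (bv σ 1 a b) (bv σ 0 1 c) (bv σ 0 0 1) F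

theorem expand {d : ℕ} {F : Form} (hF : F.IsHomogeneous d) (σ : Equiv.Perm (Fin 3)) (a b c : ℂ) (s t z : ℂ) :
    MvPolynomial.aeval (s • bv σ 1 a b + t • bv σ 0 1 c + z • bv σ 0 0 1) F =
      ∑ m ∈ Idx d, MvPolynomial.coeff m (f' σ a b c F) * (s ^ m 0 * t ^ m 1 * z ^ m 2) := by
  have h1 := tr3_aeval (bv σ 1 a b) (bv σ 0 1 c) (bv σ 0 0 1) F ![s, t, z]
  have h2 := aeval_hom (tr3_hom hF (bv σ 1 a b) (bv σ 0 1 c) (bv σ 0 0 1)) ![s, t, z]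
  simp at h1 h2
  rw [MvPolynomial.aeval_eq_eval, ← h1, h2]; rfl

theorem x_decomp (σ : Equiv.Perm (Fin 3)) (a b c : ℂ) (x : V3) :
    x = x (σ 0) • bv σ 1 a b + (x (σ 1) - a * x (σ 0)) • bv σ 0 1 c +
      (x (σ 2) - b * x (σ 0) - c * (x (σ 1) - a * x (σ 0))) • bv σ 0 0 1 := by
  apply ext_perm σ <;> simp only [Pi.add_apply, Pi.smul_apply, smul_eq_mul, bv0, bv1, bv2] <;> ring

theorem tr3_aeval_poly (v w z : V3) (F : Form) (x : Fin 3 → Polynomial ℂ) :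
    MvPolynomial.aeval x (tr3 v w z F) = MvPolynomial.aeval (fun i => Polynomial.C (v i) * x 0 + Polynomial.C (w i) * x 1 + Polynomial.C (z i) * x 2) F := by
  unfold tr3
  rw [MvPolynomial.comp_aeval_apply]
  congr 2
  funext i
  simp

theorem coeff1 {d : ℕ} {F : Form} (hF : F.IsHomogeneous d) (v w z : V3) (m : Fin 3 →₀ ℕ) (hm : m ∈ Idx d) (h2 : m 2 = 0) :
    MvPolynomial.coeff m (tr3 v w z F) = (lp F v w).coeff (m 1) := by
  have h1 := tr3_aeval_poly v w z F ![1, Polynomial.X, 0]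
  have h3 := aeval_hom (tr3_hom hF v w z) (![1, Polynomial.X, 0] : Fin 3 → Polynomial ℂ)
  have h4 : lp F v w = MvPolynomial.aeval (![1, Polynomial.X, 0] : Fin 3 → Polynomial ℂ) (tr3 v w z F) := by
    rw [h1]
    unfold lp
    congr 2
    funext i
    simp
  rw [h3] at h4
  rw [h4, Polynomial.finset_sum_coeff, Finset.sum_eq_single m]
  · simp [h2]
  · intro m' hm' hne
    rw [mem_Idx] at hm hm'
    by_cases h2' : m' 2 = 0
    · have : m 1 ≠ m' 1 := by
        intro h
        apply hne
        ext i
        fin_cases i <;> simp <;> omega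
      simp [h2', Polynomial.coeff_X_pow, this]
    · simp [h2']
  · intro h; exact absurd hm h

theorem coeff2 {d : ℕ} {F : Form} (hF : F.IsHomogeneous d) (v w z : V3) (m : Fin 3 →₀ ℕ) (hm : m ∈ Idx d) (h2 : m 1 = 0) :
    MvPolynomial.coeff m (tr3 v w z F) = (lp F v z).coeff (m 2) := by
  have h1 := tr3_aeval_poly v w z F ![1, 0, Polynomial.X]
  have h3 := aeval_hom (tr3_hom hF v w z) (![1, 0, Polynomial.X] : Fin 3 → Polynomial ℂ)
  have h4 : lp F v z = MvPolynomial.aeval (![1, 0, Polynomial.X] : Fin 3 → Polynomial ℂ) (tr3 v w z F) := by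
    rw [h1]
    unfold lp
    congr 2
    funext i
    simp
  rw [h3] at h4
  rw [h4, Polynomial.finset_sum_coeff, Finset.sum_eq_single m]
  · simp [h2]
  · intro m' hm' hne
    rw [mem_Idx] at hm hm'
    by_cases h2' : m' 1 = 0
    · have : m 2 ≠ m' 2 := by
        intro h
        apply hne
        ext i
        fin_cases i <;> simp <;> omega
      simp [h2', Polynomial.coeff_X_pow, this]
    · simp [h2']
  · intro h; exact absurd hm h

def mon (i j k : ℕ) : Fin 3 →₀ ℕ := Finsupp.equivFunOnFinite.symm ![i, j, k]
theorem mon0 (i j k : ℕ) : mon i j k 0 = i := rfl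
theorem mon1 (i j k : ℕ) : mon i j k 1 = j := rfl
theorem mon2 (i j k : ℕ) : mon i j k 2 = k := rfl

theorem card_bound {d n : ℕ} (p : (Fin 3 →₀ ℕ) → Prop) [DecidablePred p] (g : Fin n → (Fin 3 →₀ ℕ)) (hg : Function.Injective g)
    (hd : ∀ i, g i ∈ Idx d) (hp : ∀ i, ¬ p (g i)) : ((Idx d).filter p).card + n ≤ (Idx d).card := by
  have h1 : (Finset.univ.image g).card = n := by rw [Finset.card_image_of_injective _ hg]; simp
  rw [← h1, ← Finset.card_union_of_disjoint]
  · apply Finset.card_le_card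
    intro m hm
    rw [Finset.mem_union] at hm
    rcases hm with hm | hm
    · exact (Finset.mem_filter.mp hm).1
    · obtain ⟨i, _, rfl⟩ := Finset.mem_image.mp hm
      exact hd i
  · rw [Finset.disjoint_left]
    intro m hm hm'
    obtain ⟨i, _, rfl⟩ := Finset.mem_image.mp hm'
    exact hp i (Finset.mem_filter.mp hm).2

theorem gen_smooth_aux {d : ℕ} (hd : 2 ≤ d) (σ : Equiv.Perm (Fin 3)) :
    Gen d (fun F => ∀ a b : ℂ, ∃ w, ¬ ContactLE F (bv σ 1 a b) w 2) := by
  classical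
  let p : (Fin 3 →₀ ℕ) → Prop := fun m => m 0 + 2 ≤ d
  let sX : MvPolynomial (Fin 3) (MvPolynomial (Fin 2) ℂ) := MvPolynomial.X (σ 0)
  let tX : MvPolynomial (Fin 3) (MvPolynomial (Fin 2) ℂ) := MvPolynomial.X (σ 1) - MvPolynomial.C (MvPolynomial.X 0) * sX
  let zX : MvPolynomial (Fin 3) (MvPolynomial (Fin 2) ℂ) := MvPolynomial.X (σ 2) - MvPolynomial.C (MvPolynomial.X 1) * sX
  have hcard : ((Idx d).filter p).card + 3 ≤ (Idx d).card := by
    apply card_bound p (![mon d 0 0, mon (d-1) 1 0, mon (d-1) 0 1])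
    · intro i j h
      have h1 := DFunLike.congr_fun h 1
      have h2 := DFunLike.congr_fun h 2
      fin_cases i <;> fin_cases j <;> simp [mon1, mon2] at h1 h2 ⊢
    · intro i
      rw [mem_Idx]
      fin_cases i <;> simp [mon0, mon1, mon2] <;> omega
    · intro i
      fin_cases i <;> simp [p, mon0] <;> omega
  have := dimcount (d := d) (κ := Fin 2) (J := ↥((Idx d).filter p))
    (fun m => sX ^ m.1 0 * tX ^ m.1 1 * zX ^ m.1 2) (by simp only [Fintype.card_fin, Fintype.card_coe]; omega)
  refine this.mono fun F hF hne a b => ?_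
  by_contra hcon
  push Not at hcon
  have hz : ∀ m ∈ Idx d, ¬ p m → MvPolynomial.coeff m (f' σ a b 0 F) = 0 := by
    intro m hm hp
    have hm' := mem_Idx.mp hm
    have hlow : ∀ w n, n < 2 → (lp F (bv σ 1 a b) w).coeff n = 0 := by
      intro w n hn
      have := (contact_iff F _ _).mp (hcon w)
      interval_cases n
      · rw [lp_coeff_zero, this.1]
      · rw [lp_coeff_one, this.2]
    simp only [p] at hp
    by_cases h2 : m 2 = 0
    · rw [f', coeff1 hF _ _ _ m hm h2]; exact hlow _ _ (by omega)
    · rw [f', coeff2 hF _ _ _ m hm (by omega)]; exact hlow _ _ (by omega)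
  refine hne ![a, b] (fun m => MvPolynomial.coeff m.1 (f' σ a b 0 F)) ?_
  apply MvPolynomial.funext
  intro x
  have h1 := expand hF σ a b 0 (x (σ 0)) (x (σ 1) - a * x (σ 0)) (x (σ 2) - b * x (σ 0) - 0 * (x (σ 1) - a * x (σ 0)))
  rw [← x_decomp] at h1
  rw [← MvPolynomial.aeval_eq_eval, h1]
  simp only [map_sum, map_mul, MvPolynomial.aeval_eq_eval, MvPolynomial.eval_C, map_pow, sX, tX, zX, map_sub, MvPolynomial.map_X, MvPolynomial.map_C, MvPolynomial.eval_X]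
  rw [Finset.sum_coe_sort ((Idx d).filter p) (fun m => MvPolynomial.coeff m (f' σ a b 0 F) * (x (σ 0) ^ m 0 * (x (σ 1) - (![a, b] : Fin 2 → ℂ) 0 * x (σ 0)) ^ m 1 * (x (σ 2) - (![a, b] : Fin 2 → ℂ) 1 * x (σ 0)) ^ m 2))]
  rw [Finset.sum_filter]
  apply Finset.sum_congr rfl
  intro m hm
  split_ifs with hp
  · simp
  · rw [hz m hm hp]; simp

theorem exists_perm0 (i : Fin 3) : ∃ σ : Equiv.Perm (Fin 3), σ 0 = i := ⟨Equiv.swap 0 i, by simp⟩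

theorem contact_smul {d : ℕ} {F : Form} (hF : F.IsHomogeneous d) (v w : V3) (c : ℂ) (h : ContactLE F v w 2) :
    ContactLE F (c • v) w 2 := by
  rw [contact_iff] at h ⊢
  rw [aeval_smul hF, gr_smul_left hF, h.1, h.2]; simp

theorem gen_smooth {d : ℕ} (hd : 2 ≤ d) : Gen d Smooth := by
  refine (Gen.all (gen_smooth_aux hd)).mono fun F hF h => ⟨fun v hv => ?_⟩
  by_contra hcon
  push Not at hcon
  obtain ⟨i, hi⟩ : ∃ i, v i ≠ 0 := by
    by_contra hh; push Not at hh; exact hv (funext hh)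
  obtain ⟨σ, rfl⟩ := exists_perm0 i
  obtain ⟨w, hw⟩ := h σ (v (σ 1) / v (σ 0)) (v (σ 2) / v (σ 0))
  apply hw
  have : bv σ 1 (v (σ 1) / v (σ 0)) (v (σ 2) / v (σ 0)) = (v (σ 0))⁻¹ • v := by
    apply ext_perm σ <;> simp only [Pi.smul_apply, smul_eq_mul, bv0, bv1, bv2] <;> field_simp
  rw [this]
  exact contact_smul hF _ _ _ (hcon w)

end Bit

namespace Bit
open Polynomial

theorem homog_eval (D : ℕ) (H : ℂ[X]) (hH : H.natDegree ≤ D) (s t : ℂ) (ht : t ≠ 0) :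
    t ^ D * H.eval (s / t) = ∑ j : Fin (D + 1), H.coeff j * (s ^ (j : ℕ) * t ^ (D - j)) := by
  rw [eval_eq_sum_range' (Nat.lt_succ_of_le hH), Finset.mul_sum, ← Fin.sum_univ_eq_sum_range (fun j => t ^ D * (H.coeff j * (s / t) ^ j))]
  apply Finset.sum_congr rfl
  intro j _
  have hj : (j : ℕ) ≤ D := by omega
  have : t ^ D = t ^ (j : ℕ) * t ^ (D - j) := by rw [← pow_add]; congr 1; omega
  rw [this, div_pow]
  field_simp

theorem line_eval {d r : ℕ} (hr : 4 + r ≤ d) (hr2 : r ≤ 2) {F : Form} (hF : F.IsHomogeneous d) (v w : V3) (e : Fin r → ℂ) (H : ℂ[X])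
    (hH : H.natDegree ≤ d - 4 - r) (h : lp F w v = (∏ i, (X - C (e i)) ^ 2) * H) (s t : ℂ) :
    MvPolynomial.aeval (s • v + t • w) F =
      ∑ j : Fin (d - 4 - r + 1), H.coeff j * (t ^ (4 - r) * (∏ i, (s - e i * t) ^ 2) * (s ^ (j : ℕ) * t ^ (d - 4 - r - j))) := by
  by_cases ht : t = 0
  · subst ht
    have h1 : (lp F w v).coeff d = 0 := by
      apply coeff_eq_zero_of_natDegree_lt
      rw [h]
      refine natDegree_mul_le.trans_lt ?_
      have : (∏ i, (X - C (e i)) ^ 2 : ℂ[X]).natDegree ≤ 2 * r := by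
        refine (natDegree_prod_le _ _).trans ?_
        simp only [natDegree_pow, natDegree_X_sub_C]
        simp; omega
      omega
    rw [lp_coeff_top hF] at h1
    rw [zero_smul, add_zero, aeval_smul hF, h1]
    symm
    rw [mul_zero]
    apply Finset.sum_eq_zero
    intro j _
    rw [zero_pow (by omega)]; ring
  · have h1 : s • v + t • w = t • (w + (s / t) • v) := by
      rw [smul_add, smul_smul, mul_div_cancel₀ _ ht, add_comm]
    rw [h1, aeval_smul hF, ← lp_eval, h, eval_mul]
    have h2 : ∏ i, (s - e i * t) ^ 2 = t ^ (2 * r) * (∏ i, (X - C (e i)) ^ 2 : ℂ[X]).eval (s / t) := by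
      rw [eval_prod, pow_mul, show (t ^ 2) ^ r = ∏ i : Fin r, t ^ 2 by simp, ← Finset.prod_mul_distrib]
      apply Finset.prod_congr rfl
      intro i _
      simp
      field_simp
    have h3 := homog_eval _ H hH s t ht
    have h4 : t ^ d = t ^ (4 - r) * t ^ (2 * r) * t ^ (d - 4 - r) := by
      rw [← pow_add, ← pow_add]; congr 1; omega
    rw [h4, h2]
    calc _ = t ^ (4 - r) * (t ^ (2 * r) * eval (s / t) (∏ i, (X - C (e i)) ^ 2)) * (t ^ (d - 4 - r) * eval (s / t) H) := by ring
      _ = _ := by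
        rw [h3, Finset.mul_sum]
        apply Finset.sum_congr rfl
        intro j _
        ring

theorem gen_line_aux {d r : ℕ} (hr : 4 + r ≤ d) (hr2 : r ≤ 2) (σ : Equiv.Perm (Fin 3)) :
    Gen d (fun F => ∀ (a b c : ℂ) (e : Fin r → ℂ) (H : ℂ[X]), H.natDegree ≤ d - 4 - r →
      lp F (bv σ 0 1 c) (bv σ 1 a b) ≠ (∏ i, (X - C (e i)) ^ 2) * H) := by
  classical
  let p : (Fin 3 →₀ ℕ) → Prop := fun m => m 2 ≠ 0
  let sX : MvPolynomial (Fin 3) (MvPolynomial (Fin 3 ⊕ Fin r) ℂ) := MvPolynomial.X (σ 0)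
  let tX : MvPolynomial (Fin 3) (MvPolynomial (Fin 3 ⊕ Fin r) ℂ) := MvPolynomial.X (σ 1) - MvPolynomial.C (MvPolynomial.X (Sum.inl 0)) * sX
  let zX : MvPolynomial (Fin 3) (MvPolynomial (Fin 3 ⊕ Fin r) ℂ) :=
    MvPolynomial.X (σ 2) - MvPolynomial.C (MvPolynomial.X (Sum.inl 1)) * sX - MvPolynomial.C (MvPolynomial.X (Sum.inl 2)) * tX
  have hcard : ((Idx d).filter p).card + (d + 1) ≤ (Idx d).card := by
    apply card_bound p (fun j : Fin (d + 1) => mon j (d - j) 0)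
    · intro i j h
      have h1 := DFunLike.congr_fun h 0
      simp only [mon0] at h1
      exact Fin.ext h1
    · intro i
      rw [mem_Idx]
      simp only [mon0, mon1, mon2]
      omega
    · intro i
      simp [p, mon2]
  have := dimcount (d := d) (κ := Fin 3 ⊕ Fin r) (J := ↥((Idx d).filter p) ⊕ Fin (d - 4 - r + 1))
    (Sum.elim (fun m => sX ^ m.1 0 * tX ^ m.1 1 * zX ^ m.1 2)
      (fun j => tX ^ (4 - r) * (∏ i, (sX - MvPolynomial.C (MvPolynomial.X (Sum.inr i)) * tX) ^ 2) * (sX ^ (j : ℕ) * tX ^ (d - 4 - r - j))))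
    (by simp only [Fintype.card_fin, Fintype.card_coe, Fintype.card_sum]; omega)
  refine this.mono fun F hF hne a b c e H hH heq => ?_
  refine hne (Sum.elim ![a, b, c] e) (Sum.elim (fun m => MvPolynomial.coeff m.1 (f' σ a b c F)) (fun j => H.coeff j)) ?_
  apply MvPolynomial.funext
  intro x
  have h1 := expand hF σ a b c (x (σ 0)) (x (σ 1) - a * x (σ 0)) (x (σ 2) - b * x (σ 0) - c * (x (σ 1) - a * x (σ 0)))
  have h2 := expand hF σ a b c (x (σ 0)) (x (σ 1) - a * x (σ 0)) 0
  rw [← x_decomp] at h1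
  rw [zero_smul, add_zero, line_eval hr hr2 hF _ _ e H hH heq] at h2
  rw [← MvPolynomial.aeval_eq_eval, h1, Fintype.sum_sum_type]
  simp only [Sum.elim_inl, Sum.elim_inr, map_add, map_sum, map_mul, map_prod, MvPolynomial.aeval_eq_eval, MvPolynomial.eval_C, map_pow, sX, tX, zX, map_sub, MvPolynomial.map_X, MvPolynomial.map_C, MvPolynomial.eval_X]
  have e0 : (![a, b, c] : Fin 3 → ℂ) 0 = a := rfl
  have e1 : (![a, b, c] : Fin 3 → ℂ) 1 = b := rfl
  have e2 : (![a, b, c] : Fin 3 → ℂ) 2 = c := rfl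
  rw [e0, e1, e2, h2]
  rw [Finset.sum_coe_sort ((Idx d).filter p) (fun m => MvPolynomial.coeff m (f' σ a b c F) * (x (σ 0) ^ m 0 * (x (σ 1) - a * x (σ 0)) ^ m 1 * (x (σ 2) - b * x (σ 0) - c * (x (σ 1) - a * x (σ 0))) ^ m 2))]
  rw [Finset.sum_filter, ← Finset.sum_add_distrib]
  apply Finset.sum_congr rfl
  intro m hm
  by_cases hp : m 2 = 0
  · simp [p, hp]
  · simp [p, hp]

theorem exists_perm01 : ∀ i j : Fin 3, i ≠ j → ∃ σ : Equiv.Perm (Fin 3), σ 0 = i ∧ σ 1 = j := by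
  decide

theorem normalize (v w : V3) (h : LinearIndependent ℂ ![v, w]) :
    ∃ (σ : Equiv.Perm (Fin 3)) (a b c α β γ : ℂ), α ≠ 0 ∧ β ≠ 0 ∧ bv σ 1 a b = α • v ∧ bv σ 0 1 c = β • w + γ • v := by
  have hv : v ≠ 0 := by
    rintro rfl
    have := li_smul_eq h 1 0 (by simp)
    simp at this
  obtain ⟨i, hi⟩ : ∃ i, v i ≠ 0 := by
    by_contra hh; push Not at hh; exact hv (funext hh)
  let w' : V3 := w + (-(w i / v i)) • v
  have hw' : w' ≠ 0 := by
    intro h0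
    have := li_smul_eq h (-(w i / v i)) 1 (by rw [one_smul, add_comm]; exact h0)
    simp at this
  have hw'i : w' i = 0 := by simp [w']; field_simp; ring
  obtain ⟨j, hj⟩ : ∃ i, w' i ≠ 0 := by
    by_contra hh; push Not at hh; exact hw' (funext hh)
  have hij : i ≠ j := by rintro rfl; exact hj hw'i
  obtain ⟨σ, h0, h1⟩ := exists_perm01 i j hij
  refine ⟨σ, v (σ 1) / v i, v (σ 2) / v i, w' (σ 2) / w' j, (v i)⁻¹, (w' j)⁻¹, (w' j)⁻¹ * (-(w i / v i)), inv_ne_zero hi, inv_ne_zero hj, ?_, ?_⟩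
  · apply ext_perm σ <;> simp only [Pi.smul_apply, smul_eq_mul, bv0, bv1, bv2] <;> (try simp only [h0]) <;> field_simp
  · rw [mul_smul, ← smul_add]
    change _ = (w' j)⁻¹ • w'
    apply ext_perm σ <;> simp only [Pi.smul_apply, smul_eq_mul, bv0, bv1, bv2] <;> (try simp only [h0, h1, hw'i]) <;> field_simp <;> (try ring)

theorem gen_line {d r : ℕ} (hr : 4 + r ≤ d) (hr2 : r ≤ 2) :
    Gen d (fun F => ∀ v w, LinearIndependent ℂ ![v, w] → ∀ e : Fin r → ℂ, (linePoly F w v).natDegree + (4 - r) ≤ d →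
      (∏ i, (X - C (e i)) ^ 2) ∣ linePoly F w v → False) := by
  refine (Gen.all (gen_line_aux hr hr2)).mono fun F hF hne v w hli e hdeg hdvd => ?_
  rw [← lp_eq_linePoly] at hdeg hdvd
  obtain ⟨H, hH⟩ := hdvd
  have hmon : (∏ i, (X - C (e i)) ^ 2 : ℂ[X]).Monic := monic_prod_of_monic _ _ (fun i _ => (monic_X_sub_C _).pow 2)
  have hHd : H.natDegree ≤ d - 4 - r := by
    by_cases h0 : H = 0
    · simp [h0]
    have h1 := hmon.natDegree_mul' h0
    rw [← hH, natDegree_prod_of_monic _ _ (fun i _ => (monic_X_sub_C _).pow 2)] at h1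
    simp only [natDegree_pow, natDegree_X_sub_C] at h1
    simp at h1
    omega
  obtain ⟨σ, a, b, c, α, β, γ, hα, hβ, hv, hw⟩ := normalize v w hli
  let L : ℂ[X] := C (γ / β) + X * C (α / β)
  refine hne σ a b c (fun i => (e i - γ / β) / (α / β)) (C (β ^ d * ((α / β) ^ 2) ^ r) * H.comp L) ?_ ?_
  · refine (natDegree_C_mul_le _ _).trans (natDegree_comp_le.trans ?_)
    have : L.natDegree ≤ 1 := lin_deg _ _
    nlinarith
  · have e1 : bv σ 0 1 c = β • (w + (γ / β) • v) := by
      rw [hw, smul_add, smul_smul, mul_div_cancel₀ _ hβ]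
    have e2 : bv σ 1 a b = β • ((α / β) • v) := by
      rw [hv, smul_smul, mul_div_cancel₀ _ hβ]
    rw [e1, e2, lp_smul hF, ← lp_comp, hH, mul_comp, prod_comp]
    have e3 : ∏ i, ((X - C (e i)) ^ 2 : ℂ[X]).comp (C (γ / β) + X * C (α / β)) =
        C (((α / β) ^ 2) ^ r) * ∏ i, (X - C ((e i - γ / β) / (α / β))) ^ 2 := by
      rw [C_pow, show (C ((α / β) ^ 2) : ℂ[X]) ^ r = ∏ i : Fin r, C ((α / β) ^ 2) by simp, ← Finset.prod_mul_distrib]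
      apply Finset.prod_congr rfl
      intro i _
      rw [pow_comp, C_pow, ← mul_pow]
      congr 1
      rw [mul_sub, ← C_mul, mul_div_cancel₀ _ (div_ne_zero hα hβ)]
      simp only [sub_comp, X_comp, C_comp, C_sub]
      ring
    rw [e3, C_mul]
    ring

theorem gen_good {d : ℕ} (hd : 4 ≤ d) : Gen d (Good d) := by
  have h0 := gen_line (d := d) (r := 0) (by omega) (by omega)
  have h1 : Gen d (fun F => 5 ≤ d → ∀ v w, LinearIndependent ℂ ![v, w] → ∀ e : Fin 1 → ℂ, (linePoly F w v).natDegree + (4 - 1) ≤ d →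
      (∏ i, (X - C (e i)) ^ 2) ∣ linePoly F w v → False) := by
    by_cases h : 5 ≤ d
    · exact (gen_line (d := d) (r := 1) (by omega) (by omega)).mono fun F _ hh _ => hh
    · exact h0.mono fun F _ _ hh => absurd hh h
  have h2 : Gen d (fun F => 6 ≤ d → ∀ v w, LinearIndependent ℂ ![v, w] → ∀ e : Fin 2 → ℂ, (linePoly F w v).natDegree + (4 - 2) ≤ d →
      (∏ i, (X - C (e i)) ^ 2) ∣ linePoly F w v → False) := by
    by_cases h : 6 ≤ d
    · exact (gen_line (d := d) (r := 2) (by omega) (by omega)).mono fun F _ hh _ => hh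
    · exact h0.mono fun F _ _ hh => absurd hh h
  refine ((gen_smooth (by omega : 2 ≤ d)).and (h0.and (h1.and h2))).mono ?_
  rintro F hF ⟨hs, g0, g1, g2⟩
  have ga : ∀ v w, LinearIndependent ℂ ![v, w] → (linePoly F w v).natDegree + 4 ≤ d → False := by
    intro v w hli hdeg
    exact g0 v w hli ![] (by simpa using hdeg) (by simp)
  refine ⟨hs, ga, ?_, ?_⟩
  · intro v w hli a hdeg hdvd
    by_cases hz : linePoly F w v = 0
    · exact ga v w hli (by rw [hz]; simpa using hd)
    have := natDegree_le_of_dvd hdvd hz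
    rw [natDegree_pow, natDegree_X_sub_C] at this
    exact g1 (by omega) v w hli (fun _ => a) (by omega) (by simpa using hdvd)
  · intro v w hli a b hdeg hdvd
    by_cases hz : linePoly F w v = 0
    · exact ga v w hli (by rw [hz]; simpa using hd)
    have := natDegree_le_of_dvd hdvd hz
    rw [((monic_X_sub_C a).pow 2).natDegree_mul ((monic_X_sub_C b).pow 2), natDegree_pow, natDegree_X_sub_C, natDegree_pow, natDegree_X_sub_C] at this
    exact g2 (by omega) v w hli ![a, b] (by omega) (by simpa [Fin.prod_univ_two] using hdvd)

end Bit

namespace Bit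
open Polynomial

theorem no_line {d : ℕ} (hd : 2 ≤ d) {F : Form} (hF : F.IsHomogeneous d) (hs : Smooth F) (v w : V3)
    (hli : LinearIndependent ℂ ![v, w]) : lp F v w ≠ 0 := by
  intro h0
  have hw0 : w ≠ 0 := by
    rintro rfl
    have := li_smul_eq hli 0 1 (by simp)
    simp at this
  have hFw : MvPolynomial.aeval w F = 0 := by rw [← lp_coeff_top hF v w, h0, coeff_zero]
  obtain ⟨c, hc⟩ := hs.exists w hw0 hFw
  have hwv : gr F w v = 0 := by rw [← lp_coeff_pred (by omega) hF v w, h0, coeff_zero]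
  have hww : gr F w w = 0 := by rw [gr_self hF, hFw, mul_zero]
  let g : ℂ[X] := ∑ i, lp (MvPolynomial.pderiv i F) v w * C (c i)
  have hgd : g.coeff (d - 1) = gr F w c := by
    simp only [g, finset_sum_coeff, coeff_mul_C, gr]
    exact Finset.sum_congr rfl fun i _ => by rw [lp_coeff_top hF.pderiv]
  have hge : ∀ s, g.eval s = gr F (v + s • w) c := by
    intro s
    simp only [g, eval_finset_sum, eval_mul, eval_C, lp_eval, gr]
  have hdeg : g.degree ≠ 0 := by
    have h1 := le_degree_of_ne_zero (hgd ▸ hc : g.coeff (d - 1) ≠ 0)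
    intro h2
    rw [h2] at h1
    have : d - 1 ≤ 0 := by exact_mod_cast h1
    omega
  obtain ⟨s, hsr⟩ := IsAlgClosed.exists_root g hdeg
  have hgs : gr F (v + s • w) c = 0 := by rw [← hge]; exact hsr
  have hFp : MvPolynomial.aeval (v + s • w) F = 0 := by rw [← lp_eval, h0, eval_zero]
  have hpw : gr F (v + s • w) w = 0 := by rw [← lp_eval_derivative, h0]; simp
  have hpv : gr F (v + s • w) v = 0 := by
    have := gr_self hF (v + s • w)
    rw [hFp, mul_zero, gr_add, gr_smul, hpw, mul_zero, add_zero] at this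
    exact this
  have hp0 : v + s • w ≠ 0 := by
    intro h
    have := li_smul_eq hli 1 s (by rw [one_smul]; exact h)
    simp at this
  obtain ⟨c', hc'⟩ := hs.exists _ hp0 hFp
  obtain ⟨α, β, he⟩ := span3 (grL F w) v w c hwv hww hli hc c'
  apply hc'
  rw [he, gr_add, gr_add, gr_smul, gr_smul, gr_smul, hpv, hpw, hgs]
  simp

theorem low_degree {d : ℕ} (hd : 2 ≤ d) (hd3 : d ≤ 3) {F : Form} (hF : F.IsHomogeneous d) (hs : Smooth F) :
    bitangentLines F = ∅ := by
  rw [Set.eq_empty_iff_forall_notMem]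
  rintro W ⟨_, v, w, _, _, hli, h1, h2⟩
  rw [contact_iff] at h1 h2
  apply no_line hd hF hs v w hli
  have hdeg := natDegree_two hd hF w v h2.1 h2.2
  ext n
  rw [coeff_zero]
  by_cases hn : n < 2
  · interval_cases n
    · rw [lp_coeff_zero, h1.1]
    · rw [lp_coeff_one, h1.2]
  · exact coeff_eq_zero_of_natDegree_lt (by omega)

theorem main (d : ℕ) (hd : 2 ≤ d) : Gen d (fun F => F ≠ 0 → (bitangentLines F).Finite ∧
            2 * ((bitangentLines F).ncard : ℤ) =
              (d : ℤ) * ((d : ℤ) - 2) * ((d : ℤ) ^ 2 - 9)) := by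
  by_cases h4 : 4 ≤ d
  · refine (gen_good h4).mono fun F hF hG hF0 => ?_
    obtain ⟨k, rfl⟩ : ∃ k, d = k + 3 := ⟨d - 3, by omega⟩
    obtain ⟨h1, h2⟩ := count_good hF hF0 hG (by omega)
    refine ⟨h1, ?_⟩
    have h3 : (2 : ℤ) * ((bitangentLines F).ncard : ℤ) = ((k : ℤ) + 3) * (k * ((k + 1) * (k + 6))) := by exact_mod_cast h2
    rw [h3]; push_cast; ring
  · refine (gen_smooth hd).mono fun F hF hS _ => ?_
    rw [low_degree hd (by omega) hF hS]
    refine ⟨Set.finite_empty, ?_⟩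
    interval_cases d <;> simp

theorem final (d : ℕ) (hd : 2 ≤ d) :
    ∃ Q : MvPolynomial (Fin 3 →₀ ℕ) ℂ,
      (∃ F : MvPolynomial (Fin 3) ℂ, F.IsHomogeneous d ∧ F ≠ 0 ∧
          MvPolynomial.eval (coeffs1 F) Q ≠ 0) ∧
      ∀ F : MvPolynomial (Fin 3) ℂ, F.IsHomogeneous d → F ≠ 0 →
        MvPolynomial.eval (coeffs1 F) Q ≠ 0 →
          (bitangentLines F).Finite ∧
            2 * ((bitangentLines F).ncard : ℤ) =
              (d : ℤ) * ((d : ℤ) - 2) * ((d : ℤ) ^ 2 - 9) := by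
  obtain ⟨Q, h1, h2⟩ := (main d hd).final
  exact ⟨Q, h1, fun F hF hF0 hne => h2 F hF hF0 hne hF0⟩

end Bit

/-- A general plane curve of degree `d` has exactly `d(d−2)(d²−9)/2` bitangent lines
(stated multiplied by 2 to avoid division). -/
theorem bitangent_count_general_curve (d : ℕ) (hd : 2 ≤ d) :
    ∃ Q : MvPolynomial (Fin 3 →₀ ℕ) ℂ,
      (∃ F : MvPolynomial (Fin 3) ℂ, F.IsHomogeneous d ∧ F ≠ 0 ∧
          MvPolynomial.eval (coeffs1 F) Q ≠ 0) ∧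
      ∀ F : MvPolynomial (Fin 3) ℂ, F.IsHomogeneous d → F ≠ 0 →
        MvPolynomial.eval (coeffs1 F) Q ≠ 0 →
          (bitangentLines F).Finite ∧
            2 * ((bitangentLines F).ncard : ℤ) =
              (d : ℤ) * ((d : ℤ) - 2) * ((d : ℤ) ^ 2 - 9) := by
  exact Bit.final d hd
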